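/- Let k ≥ 1 be an integer and 0 < α < 1, and let Ω ⊂ ℂ be a bounded Jordan domain of class C^{k,α} (its boundary Jordan curve admits a C^{k,α} parametrization γ: [0,1] → bΩ with nonvanishing derivative). If u ∈ C^{k,α}(bΩ), then u can be written uniquely as u = h + H on bΩ, where h is holomorphic on Ω and extends to a function in C^{k,α}(Ω̄), and H is holomorphic on ℂ ∖ Ω̄, extends to a function in C^{k,α}(ℂ ∖ Ω), and vanishes at infinity. -/

import Mathlib

open Complex MeasureTheory Metric Set Filter
open scoped ENNReal NNReal Topology

noncomputable section

/-- `Ω` is a bounded Jordan domain of class `C^{k,α}`: its boundary Jordan curve is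
parametrized by the 1-periodic map `γ` which is `C^k` with nonvanishing derivative and
whose `k`-th derivative is `α`-Hölder continuous. -/
structure CkAlphaJordanDomain (Ω : Set ℂ) (γ : ℝ → ℂ) (k : ℕ) (α : ℝ≥0) : Prop where
  isOpen : IsOpen Ω
  bounded : Bornology.IsBounded Ω
  nonempty : Ω.Nonempty
  periodic : Function.Periodic γ 1
  injOn : InjOn γ (Ico 0 1)
  image : γ '' (Icc 0 1) = frontier Ω
  smooth : ContDiff ℝ k γ
  derivNe : ∀ t : ℝ, deriv γ t ≠ 0
  holder : ∃ C : ℝ≥0, HolderOnWith C α (iteratedDeriv k γ) (Icc 0 1)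

/-- `f` belongs to `C^{k,α}(S)`: it is `C^k` on `S` (in the sense of derivatives within
`S`) and its `k`-th derivative is `α`-Hölder continuous on `S`. -/
def CkAlphaOn (f : ℂ → ℂ) (k : ℕ) (α : ℝ≥0) (S : Set ℂ) : Prop :=
  ContDiffOn ℝ k f S ∧
    ∃ C : ℝ≥0, HolderOnWith C α (iteratedFDerivWithin ℝ k f S) S

namespace CKA

/-- Global Hölder bound on the line. -/
def Hol (a : ℝ) (f : ℝ → ℂ) : Prop := ∃ C : ℝ, 0 ≤ C ∧ ∀ s t, ‖f s - f t‖ ≤ C * |s - t| ^ a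

/-- Periodic functions of class `C^{m,a}`. -/
def CH (a : ℝ) : ℕ → (ℝ → ℂ) → Prop
  | 0, f => Function.Periodic f 1 ∧ Hol a f
  | (m+1), f => Function.Periodic f 1 ∧ Differentiable ℝ f ∧ CH a m (deriv f)

theorem Hol.continuous {a : ℝ} (ha : 0 < a) {f : ℝ → ℂ} (hf : Hol a f) : Continuous f := by
  obtain ⟨C, hC, h⟩ := hf
  rw [continuous_iff_continuousAt]
  intro t
  rw [ContinuousAt, tendsto_iff_norm_sub_tendsto_zero]
  refine squeeze_zero (fun _ => norm_nonneg _) (fun s => h s t) ?_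
  have : Tendsto (fun s : ℝ => C * |s - t| ^ a) (𝓝 t) (𝓝 (C * |t - t| ^ a)) := by
    refine Tendsto.const_mul _ (Tendsto.rpow_const ?_ (Or.inr ha.le))
    exact (continuous_abs.comp (continuous_id.sub continuous_const)).tendsto t
  simpa [Real.zero_rpow ha.ne'] using this

theorem per_bdd {f : ℝ → ℂ} (hp : Function.Periodic f 1) (hf : Continuous f) :
    ∃ M : ℝ, 0 < M ∧ ∀ t, ‖f t‖ ≤ M := by
  obtain ⟨M, hM⟩ := (isCompact_Icc (a := (0:ℝ)) (b := 1)).exists_bound_of_continuousOn hf.continuousOn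
  refine ⟨max M 1, by positivity, fun t => ?_⟩
  obtain ⟨y, hy, e⟩ := hp.exists_mem_Ico₀ one_pos t
  rw [e]
  exact (hM y ⟨hy.1, hy.2.le⟩).trans (le_max_left _ _)

theorem lip_hol {a : ℝ} (ha : 0 < a) (ha1 : a < 1) {f : ℝ → ℂ} {B L : ℝ} (hL : 0 ≤ L)
    (hB : ∀ t, ‖f t‖ ≤ B)
    (h : ∀ s t, ‖f s - f t‖ ≤ L * |s - t|) : Hol a f := by
  have hB0 : 0 ≤ B := (norm_nonneg _).trans (hB 0)
  refine ⟨L + 2 * B, by positivity, fun s t => ?_⟩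
  rcases le_total |s - t| 1 with h1 | h1
  · rcases eq_or_lt_of_le (abs_nonneg (s - t)) with h0 | h0
    · have := h s t
      rw [← h0, Real.zero_rpow ha.ne'] ; rw [← h0] at this; simpa using this
    · calc _ ≤ L * |s - t| := h s t
        _ ≤ L * |s - t| ^ a := by
          gcongr
          conv_lhs => rw [← Real.rpow_one |s - t|]
          exact Real.rpow_le_rpow_of_exponent_ge h0 h1 ha1.le
        _ ≤ _ := by gcongr; linarith
  · have : 1 ≤ |s - t| ^ a := Real.one_le_rpow h1 ha.le
    calc _ ≤ ‖f s‖ + ‖f t‖ := norm_sub_le _ _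
      _ ≤ 2 * B := by linarith [hB s, hB t]
      _ ≤ (L + 2 * B) * 1 := by linarith
      _ ≤ _ := by gcongr

theorem per_deriv {f : ℝ → ℂ} (hp : Function.Periodic f 1) : Function.Periodic (deriv f) 1 := by
  intro t
  have : (fun x => f (x + 1)) = f := funext hp
  rw [← deriv_comp_add_const, this]

theorem CH.per {a : ℝ} : ∀ {m : ℕ} {f : ℝ → ℂ}, CH a m f → Function.Periodic f 1
  | 0, _, h => h.1
  | (_+1), _, h => h.1

theorem CH.cont {a : ℝ} (ha : 0 < a) : ∀ {m : ℕ} {f : ℝ → ℂ}, CH a m f → Continuous f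
  | 0, _, h => h.2.continuous ha
  | (_+1), _, h => h.2.1.continuous

theorem c1_hol {a : ℝ} (ha : 0 < a) (ha1 : a < 1) {f : ℝ → ℂ} (hp : Function.Periodic f 1)
    (hd : Differentiable ℝ f) (hc : Continuous (deriv f)) : Hol a f := by
  obtain ⟨B, hB, hB'⟩ := per_bdd hp hd.continuous
  obtain ⟨L, hL, hL'⟩ := per_bdd (per_deriv hp) hc
  refine lip_hol ha ha1 hL.le hB' fun s t => ?_
  have := Convex.norm_image_sub_le_of_norm_deriv_le (𝕜 := ℝ) (s := univ) (x := t) (y := s)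
    (fun x _ => hd x) (fun x _ => hL' x) convex_univ trivial trivial
  simpa [Real.norm_eq_abs] using this

theorem CH.mono {a : ℝ} (ha : 0 < a) (ha1 : a < 1) : ∀ {m : ℕ} {f : ℝ → ℂ}, CH a (m+1) f → CH a m f
  | 0, _, h => ⟨h.1, c1_hol ha ha1 h.1 h.2.1 (CH.cont ha h.2.2)⟩
  | (_+1), _, h => ⟨h.1, h.2.1, CH.mono ha ha1 h.2.2⟩

theorem CH.zero {a : ℝ} (ha : 0 < a) (ha1 : a < 1) : ∀ {m : ℕ} {f : ℝ → ℂ}, CH a m f → CH a 0 f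
  | 0, _, h => h
  | (_+1), _, h => CH.zero ha ha1 (CH.mono ha ha1 h)

theorem CH.add {a : ℝ} : ∀ {m : ℕ} {f g : ℝ → ℂ}, CH a m f → CH a m g →
    CH a m (fun t => f t + g t)
  | 0, f, g, hf, hg => by
    obtain ⟨C, hC, h1⟩ := hf.2
    obtain ⟨D, hD, h2⟩ := hg.2
    refine ⟨fun t => by simp only [hf.1 t, hg.1 t], C + D, by positivity, fun s t => ?_⟩
    calc _ = ‖(f s - f t) + (g s - g t)‖ := by ring_nf
      _ ≤ _ := (norm_add_le _ _).trans (by linarith [h1 s t, h2 s t])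
  | (m+1), f, g, hf, hg => by
    refine ⟨fun t => by simp only [hf.1 t, hg.1 t], hf.2.1.add hg.2.1, ?_⟩
    have : deriv (fun t => f t + g t) = fun t => deriv f t + deriv g t := by
      ext t; exact deriv_fun_add (hf.2.1 t) (hg.2.1 t)
    rw [this]
    exact CH.add hf.2.2 hg.2.2

theorem CH.mul {a : ℝ} (ha : 0 < a) (ha1 : a < 1) : ∀ {m : ℕ} {f g : ℝ → ℂ}, CH a m f → CH a m g →
    CH a m (fun t => f t * g t)
  | 0, f, g, hf, hg => by
    obtain ⟨C, hC, h1⟩ := hf.2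
    obtain ⟨D, hD, h2⟩ := hg.2
    obtain ⟨M, hM, hM'⟩ := per_bdd hf.per (hf.cont ha)
    obtain ⟨N, hN, hN'⟩ := per_bdd hg.per (hg.cont ha)
    refine ⟨fun t => by simp only [hf.1 t, hg.1 t], M * D + N * C, by positivity, fun s t => ?_⟩
    calc _ = ‖f s * (g s - g t) + g t * (f s - f t)‖ := by ring_nf
      _ ≤ ‖f s‖ * ‖g s - g t‖ + ‖g t‖ * ‖f s - f t‖ := by
        refine (norm_add_le _ _).trans ?_
        rw [norm_mul, norm_mul]
      _ ≤ M * (D * |s - t| ^ a) + N * (C * |s - t| ^ a) := by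
        gcongr
        exacts [hM' s, h2 s t, hN' t, h1 s t]
      _ = _ := by ring
  | (m+1), f, g, hf, hg => by
    refine ⟨fun t => by simp only [hf.1 t, hg.1 t], hf.2.1.mul hg.2.1, ?_⟩
    have : deriv (fun t => f t * g t) = fun t => deriv f t * g t + f t * deriv g t := by
      ext t; exact deriv_fun_mul (hf.2.1 t) (hg.2.1 t)
    rw [this]
    exact CH.add (CH.mul ha ha1 hf.2.2 (hg.mono ha ha1)) (CH.mul ha ha1 (hf.mono ha ha1) hg.2.2)

theorem CH.const {a : ℝ} (c : ℂ) : ∀ {m : ℕ}, CH a m (fun _ => c)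
  | 0 => ⟨fun _ => rfl, 0, le_rfl, by simp⟩
  | (m+1) => ⟨fun _ => rfl, differentiable_const _, by
      have : deriv (fun _ : ℝ => c) = fun _ => 0 := by ext; simp
      rw [this]; exact CH.const 0⟩

theorem per_lower {f : ℝ → ℂ} (hp : Function.Periodic f 1) (hf : Continuous f) (hn : ∀ t, f t ≠ 0) :
    ∃ M : ℝ, 0 < M ∧ ∀ t, M ≤ ‖f t‖ := by
  obtain ⟨x, _, hx⟩ := (isCompact_Icc (a := (0:ℝ)) (b := 1)).exists_isMinOn
    ⟨0, by simp⟩ hf.norm.continuousOn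
  refine ⟨‖f x‖, by simpa using hn x, fun t => ?_⟩
  obtain ⟨y, hy, e⟩ := hp.exists_mem_Ico₀ one_pos t
  rw [e]
  exact hx ⟨hy.1, hy.2.le⟩

theorem CH.inv {a : ℝ} (ha : 0 < a) (ha1 : a < 1) : ∀ {m : ℕ} {f : ℝ → ℂ}, CH a m f →
    (∀ t, f t ≠ 0) → CH a m (fun t => (f t)⁻¹)
  | 0, f, hf, hn => by
    obtain ⟨C, hC, h1⟩ := hf.2
    obtain ⟨M, hM, hM'⟩ := per_lower hf.per (hf.cont ha) hn
    refine ⟨fun t => by simp only [hf.1 t], C / (M * M), by positivity, fun s t => ?_⟩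
    rw [inv_sub_inv (hn s) (hn t), norm_div, norm_mul, norm_sub_rev, div_mul_eq_mul_div]
    gcongr
    exacts [h1 s t, hM' s, hM' t]
  | (m+1), f, hf, hn => by
    have hi := CH.inv ha ha1 (hf.mono ha ha1) hn
    refine ⟨fun t => by simp only [hf.1 t], hf.2.1.inv hn, ?_⟩
    have : deriv (fun t => (f t)⁻¹) = fun t => ((-1) * deriv f t) * ((f t)⁻¹ * (f t)⁻¹) := by
      ext t
      rw [deriv_fun_inv'' (hf.2.1 t) (hn t)]
      field_simp
    rw [this]
    exact CH.mul ha ha1 (CH.mul ha ha1 (CH.const _) hf.2.2) (CH.mul ha ha1 hi hi)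

theorem per_hol_of_Icc {a : ℝ} (ha : 0 < a) {f : ℝ → ℂ} (hp : Function.Periodic f 1) {C : ℝ}
    (hC : 0 ≤ C) (h : ∀ s ∈ Icc (0:ℝ) 1, ∀ t ∈ Icc (0:ℝ) 1, ‖f s - f t‖ ≤ C * |s - t| ^ a) :
    Hol a f := by
  -- first, distance at most one, both points in [0,2]
  have h01 : f 1 = f 0 := by simpa using hp 0
  have sub1 : ∀ x, f (x - 1) = f x := fun x => by rw [← hp (x - 1)]; simp
  have key : ∀ s ∈ Ico (0:ℝ) 1, ∀ t, s ≤ t → t ≤ s + 1 → ‖f s - f t‖ ≤ 2 * C * |s - t| ^ a := by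
    intro s hs t hst ht
    rcases le_total t 1 with h1 | h1
    · have := h s ⟨hs.1, hs.2.le⟩ t ⟨hs.1.trans hst, h1⟩
      have hp : 0 ≤ C * |s - t| ^ a := by positivity
      linarith
    · have e1 := h s ⟨hs.1, hs.2.le⟩ 1 (by simp)
      have e2 := h 0 (by simp) (t - 1) ⟨by linarith, by linarith [hs.2]⟩
      rw [sub1] at e2
      have f1 : |s - 1| ^ a ≤ |s - t| ^ a := by
        apply Real.rpow_le_rpow (abs_nonneg _) _ ha.le
        rw [abs_of_nonpos (by linarith [hs.2]), abs_of_nonpos (by linarith)]; linarith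
      have f2 : |0 - (t - 1)| ^ a ≤ |s - t| ^ a := by
        apply Real.rpow_le_rpow (abs_nonneg _) _ ha.le
        rw [abs_of_nonpos (by linarith), abs_of_nonpos (by linarith)]; linarith [hs.2]
      calc ‖f s - f t‖ = ‖(f s - f 1) + (f 0 - f t)‖ := by rw [h01]; ring_nf
        _ ≤ _ := norm_add_le _ _
        _ ≤ C * |s - 1| ^ a + C * |0 - (t - 1)| ^ a := by linarith
        _ ≤ C * |s - t| ^ a + C * |s - t| ^ a := by gcongr
        _ = _ := by ring
  have key2 : ∀ s t : ℝ, s ≤ t → ‖f s - f t‖ ≤ 2 * C * |s - t| ^ a := by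
    intro s t hst
    -- translate
    have hper : ∀ (n : ℤ) x, f (x - n) = f x := fun n x => by
      simpa using (hp.int_mul n).sub_eq x
    have e1 : f (Int.fract s) = f s := hper ⌊s⌋ s
    set m : ℤ := ⌊t - s⌋
    have e2 : f (Int.fract s + Int.fract (t - s)) = f t := by
      have : Int.fract s + Int.fract (t - s) = t - (⌊s⌋ + m : ℤ) := by
        simp only [Int.fract, m]; push_cast; ring
      rw [this, hper]
    have := key (Int.fract s) ⟨Int.fract_nonneg _, Int.fract_lt_one _⟩
      (Int.fract s + Int.fract (t - s)) (by linarith [Int.fract_nonneg (t - s)])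
      (by linarith [Int.fract_lt_one (t - s)])
    rw [e1, e2] at this
    refine this.trans (mul_le_mul_of_nonneg_left (Real.rpow_le_rpow (abs_nonneg _) ?_ ha.le)
      (by positivity))
    rw [abs_sub_comm, abs_sub_comm s, abs_of_nonneg (by linarith [Int.fract_nonneg (t - s)]),
      abs_of_nonneg (by linarith)]
    have : (0:ℝ) ≤ m := by
      have : 0 ≤ m := Int.floor_nonneg.2 (by linarith)
      exact_mod_cast this
    have : Int.fract (t - s) = t - s - m := rfl
    linarith
  refine ⟨2 * C, by positivity, fun s t => ?_⟩
  rcases le_total s t with h | h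
  · exact key2 s t h
  · rw [norm_sub_rev, abs_sub_comm]; exact key2 t s h

theorem CH.of_contDiff {α : ℝ≥0} (hα : 0 < α) : ∀ {k : ℕ} {f : ℝ → ℂ}, Function.Periodic f 1 →
    ContDiff ℝ k f → (∃ C : ℝ≥0, HolderOnWith C α (iteratedDeriv k f) (Icc 0 1)) → CH (α:ℝ) k f
  | 0, f, hp, _, ⟨C, hC⟩ => by
    refine ⟨hp, per_hol_of_Icc (by exact_mod_cast hα) hp C.2 fun s hs t ht => ?_⟩
    have := hC.dist_le hs ht
    simpa [dist_eq_norm] using this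
  | (k+1), f, hp, hd, ⟨C, hC⟩ => by
    have h1 : ContDiff ℝ ((k:WithTop ℕ∞)+1) f := by exact_mod_cast hd
    rw [contDiff_succ_iff_deriv] at h1
    refine ⟨hp, h1.1, CH.of_contDiff hα (per_deriv hp) h1.2.2 ⟨C, ?_⟩⟩
    rwa [iteratedDeriv_succ'] at hC

end CKA

namespace CKA

structure Curve (γ : ℝ → ℂ) (a : ℝ) : Prop where
  ha : 0 < a
  ha1 : a < 1
  per : Function.Periodic γ 1
  cd : ContDiff ℝ 1 γ
  ne : ∀ t, deriv γ t ≠ 0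
  inj : ∀ s t, |t - s| < 1 → γ s = γ t → s = t
  hol : Hol a (deriv γ)

variable {γ : ℝ → ℂ} {a : ℝ}

theorem Curve.cont (h : Curve γ a) : Continuous γ := h.cd.continuous
theorem Curve.diff (h : Curve γ a) : Differentiable ℝ γ := h.cd.differentiable one_ne_zero
theorem Curve.hd (h : Curve γ a) (t : ℝ) : HasDerivAt γ (deriv γ t) t := (h.diff t).hasDerivAt
theorem Curve.contd (h : Curve γ a) : Continuous (deriv γ) := h.hol.continuous h.ha
theorem Curve.perd (h : Curve γ a) : Function.Periodic (deriv γ) 1 := per_deriv h.per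

theorem Curve.chord (h : Curve γ a) : ∃ c : ℝ, 0 < c ∧ ∀ s x : ℝ, |x| ≤ 1/2 →
    c * |x| ≤ ‖γ (s + x) - γ s‖ := by
  let q : ℝ × ℝ → ℂ := fun p => ∫ r in (0:ℝ)..1, deriv γ (p.1 + p.2 * r)
  have hq : Continuous q := by
    apply intervalIntegral.continuous_parametric_intervalIntegral_of_continuous'
    exact h.contd.comp (by fun_prop)
  have hqe : ∀ s x : ℝ, (x:ℂ) * q (s, x) = γ (s + x) - γ s := by
    intro s x
    have : ∀ r ∈ uIcc (0:ℝ) 1, HasDerivAt (fun r : ℝ => γ (s + x * r)) ((x:ℂ) * deriv γ (s + x * r)) r := by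
      intro r _
      have h1 : HasDerivAt (fun r : ℝ => s + x * r) x r := by
        simpa using ((hasDerivAt_id r).const_mul x).const_add s
      exact ((h.hd (s + x * r)).scomp r h1).congr_deriv (by simp)
    have e := intervalIntegral.integral_eq_sub_of_hasDerivAt this (by
      apply Continuous.intervalIntegrable
      exact continuous_const.mul (h.contd.comp (by fun_prop)))
    rw [intervalIntegral.integral_const_mul] at e
    simpa using e
  have hne : ∀ s x : ℝ, |x| ≤ 1/2 → q (s, x) ≠ 0 := by
    intro s x hx h0
    rcases eq_or_ne x 0 with rfl | hx0
    · have : q (s, 0) = deriv γ s := by simp [q]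
      exact h.ne s (this ▸ h0)
    · have e := hqe s x
      rw [h0, mul_zero] at e
      have := h.inj s (s + x) (by simp; linarith) (sub_eq_zero.1 e.symm).symm
      exact hx0 (by linarith)
  obtain ⟨p, hp, hmin⟩ := ((isCompact_Icc (a := (0:ℝ)) (b := 1)).prod
    (isCompact_Icc (a := -(1/2:ℝ)) (b := 1/2))).exists_isMinOn
    ⟨(0, 0), by norm_num⟩ hq.norm.continuousOn
  refine ⟨‖q p‖, norm_pos_iff.2 (hne p.1 p.2 (abs_le.2 ⟨hp.2.1, hp.2.2⟩)), fun s x hx => ?_⟩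
  rw [← hqe, norm_mul, mul_comm]
  simp only [Complex.norm_real, Real.norm_eq_abs]
  gcongr
  have e : q (s, x) = q (Int.fract s, x) := by
    simp only [q]
    congr 1; ext r
    have := (h.perd.int_mul ⌊s⌋) (Int.fract s + x * r)
    rw [← this]; congr 1
    have := Int.fract_add_floor s
    linarith
  rw [e]
  exact hmin (show (Int.fract s, x) ∈ _ from
    ⟨⟨Int.fract_nonneg _, (Int.fract_lt_one _).le⟩, abs_le.1 hx⟩)

theorem Curve.trans (h : Curve γ a) : ∃ c η : ℝ, 0 < c ∧ 0 < η ∧ η ≤ 1/4 ∧ ∀ t₀ t y x : ℝ,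
    |t - t₀| ≤ η → |y| ≤ η → |x| ≤ 1/2 →
    c * (|x| + |y|) ≤ ‖γ (t + x) - (γ t + y * (I * deriv γ t₀))‖ := by
  obtain ⟨c0, hc0, hch⟩ := h.chord
  obtain ⟨m, hm, hm'⟩ := per_lower h.perd h.contd h.ne
  obtain ⟨M, hM, hM'⟩ := per_bdd h.perd h.contd
  obtain ⟨C, hC, hC'⟩ := h.hol
  obtain ⟨η1, hη1, hη1'⟩ : ∃ η1 > 0, ∀ s t, |s - t| ≤ 2 * η1 → ‖deriv γ s - deriv γ t‖ ≤ m / 2 := by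
    have : Tendsto (fun x : ℝ => C * x ^ a) (𝓝 0) (𝓝 (C * 0 ^ a)) :=
      (tendsto_id.rpow_const (Or.inr h.ha.le)).const_mul _
    rw [Real.zero_rpow h.ha.ne', mul_zero] at this
    obtain ⟨r, hr, hr'⟩ := Metric.eventually_nhds_iff.1 (this.eventually (gt_mem_nhds (half_pos hm)))
    refine ⟨r / 4, by positivity, fun s t hst => (hC' s t).trans (hr' ?_).le⟩
    rw [dist_zero_right, Real.norm_eq_abs, abs_abs]; linarith
  have hq : 0 < c0 * η1 / (2 * M) := by positivity
  refine ⟨min (m/4) (c0/4), min (min η1 (1/4)) (c0 * η1 / (2 * M)), by positivity, by positivity,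
    (min_le_left _ _).trans (min_le_right _ _), ?_⟩
  intro t₀ t y x ht hy hx
  have ht1 : |t - t₀| ≤ η1 := ht.trans ((min_le_left _ _).trans (min_le_left _ _))
  have hy1 : |y| ≤ η1 := hy.trans ((min_le_left _ _).trans (min_le_left _ _))
  have hy2 : |y| ≤ c0 * η1 / (2 * M) := hy.trans (min_le_right _ _)
  rw [le_div_iff₀ (by positivity)] at hy2
  set g := deriv γ t₀ with hg
  have hyg : ‖(y:ℂ) * (I * g)‖ = |y| * ‖g‖ := by simp
  rcases le_total |x| η1 with hx1 | hx1
  · have hmv : ‖(γ (t + x) - (t + x : ℝ) * g) - (γ t - (t:ℝ) * g)‖ ≤ m / 2 * ‖(t + x) - t‖ := by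
      refine Convex.norm_image_sub_le_of_norm_hasDerivWithin_le (𝕜 := ℝ) (f := fun r : ℝ => γ r - r * g)
        (f' := fun r => deriv γ r - g) (s := Icc (t₀ - 2 * η1) (t₀ + 2 * η1)) ?_ ?_ (convex_Icc _ _) ?_ ?_
      · intro r _
        have : HasDerivAt (fun r : ℝ => (r:ℂ) * g) (1 * g) r := (hasDerivAt_id r).ofReal_comp.mul_const g
        exact (((h.hd r).sub this).congr_deriv (by rw [one_mul])).hasDerivWithinAt
      · intro r hr
        refine hη1' _ _ (abs_le.2 ⟨by linarith [hr.1], by linarith [hr.2]⟩)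
      · have := abs_le.1 ht1; constructor <;> linarith
      · have := abs_le.1 ht1; have := abs_le.1 hx1; constructor <;> linarith
    rw [add_sub_cancel_left, Real.norm_eq_abs] at hmv
    have e : γ (t + x) - (γ t + y * (I * g)) =
        ((γ (t + x) - (t + x : ℝ) * g) - (γ t - (t:ℝ) * g)) + (⟨x, -y⟩ : ℂ) * g := by
      rw [show (⟨x, -y⟩ : ℂ) = x + (-y : ℝ) * I from by apply Complex.ext <;> simp]
      push_cast; ring
    have h1 : |x| ≤ ‖(⟨x, -y⟩ : ℂ)‖ := Complex.abs_re_le_norm ⟨x, -y⟩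
    have h2 : |y| ≤ ‖(⟨x, -y⟩ : ℂ)‖ := by simpa using Complex.abs_im_le_norm ⟨x, -y⟩
    have h3 : ‖(⟨x, -y⟩ : ℂ) * g‖ ≥ ‖(⟨x, -y⟩ : ℂ)‖ * m := by
      rw [norm_mul]; gcongr; exact hm' _
    have h4 := norm_sub_le (γ (t + x) - (γ t + y * (I * g))) ((γ (t + x) - (t + x : ℝ) * g) - (γ t - (t:ℝ) * g))
    rw [show γ (t + x) - (γ t + y * (I * g)) - ((γ (t + x) - (t + x : ℝ) * g) - (γ t - (t:ℝ) * g))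
      = (⟨x, -y⟩ : ℂ) * g from by rw [e]; ring] at h4
    calc _ ≤ m / 4 * (|x| + |y|) := by gcongr; exact min_le_left _ _
      _ ≤ _ := by nlinarith
  · have h1 := hch t x hx
    have h2 : |y| * ‖g‖ ≤ |y| * M := by gcongr; exact hM' _
    have h3 := norm_sub_le (γ (t + x) - (γ t + y * (I * g))) (-((y:ℂ) * (I * g)))
    rw [show γ (t + x) - (γ t + y * (I * g)) - -(y * (I * g)) = γ (t + x) - γ t by ring, norm_neg, hyg] at h3
    calc _ ≤ c0 / 4 * (|x| + |y|) := by gcongr; exact min_le_right _ _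
      _ ≤ _ := by nlinarith

theorem Curve.range_eq (h : Curve γ a) : range γ = γ '' Icc 0 1 := by
  apply Subset.antisymm _ (image_subset_range _ _)
  rintro _ ⟨t, rfl⟩
  obtain ⟨y, hy, e⟩ := h.per.exists_mem_Ico₀ one_pos t
  exact ⟨y, ⟨hy.1, hy.2.le⟩, e.symm⟩

theorem Curve.compact (h : Curve γ a) : IsCompact (range γ) := by
  rw [h.range_eq]; exact isCompact_Icc.image h.cont

/-- `z` is seen from the curve as being at scale `d` from `γ s`. -/
structure Low (γ : ℝ → ℂ) (c B : ℝ) (z : ℂ) (s d : ℝ) : Prop where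
  dpos : 0 < d
  close : ‖z - γ s‖ ≤ B * d
  low : ∀ x : ℝ, |x| ≤ 1/2 → c * (|x| + d) ≤ ‖γ (s + x) - z‖

theorem Curve.near (h : Curve γ a) (z : ℂ) : ∃ s ∈ Ico (0:ℝ) 1, infDist z (range γ) = ‖z - γ s‖ := by
  obtain ⟨_, ⟨t, rfl⟩, e⟩ := h.compact.exists_infDist_eq_dist (range_nonempty γ) z
  obtain ⟨y, hy, e'⟩ := h.per.exists_mem_Ico₀ one_pos t
  exact ⟨y, hy, by rw [e, dist_eq_norm, e']⟩

theorem Curve.low_near (h : Curve γ a) : ∃ c : ℝ, 0 < c ∧ ∀ z s, z ∉ range γ →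
    infDist z (range γ) = ‖z - γ s‖ → Low γ c 1 z s (infDist z (range γ)) := by
  obtain ⟨c0, hc0, hch⟩ := h.chord
  refine ⟨min (1/2) (c0/4), by positivity, fun z s hz e => ?_⟩
  have hd : 0 < infDist z (range γ) :=
    (h.compact.isClosed.notMem_iff_infDist_pos (range_nonempty γ)).1 hz
  refine ⟨hd, by rw [e]; simp, fun x hx => ?_⟩
  set d := infDist z (range γ)
  have h1 : d ≤ ‖γ (s + x) - z‖ := by
    rw [← dist_eq_norm, dist_comm]; exact infDist_le_dist_of_mem (mem_range_self _)
  have h2 := hch s x hx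
  have h3 : ‖γ (s + x) - γ s‖ ≤ ‖γ (s + x) - z‖ + ‖z - γ s‖ := norm_sub_le_norm_sub_add_norm_sub _ _ _
  have a1 := min_le_left (1/2:ℝ) (c0/4)
  have a2 := min_le_right (1/2:ℝ) (c0/4)
  have a3 := mul_le_mul_of_nonneg_right a1 hd.le
  have a4 := mul_le_mul_of_nonneg_right a2 (abs_nonneg x)
  rw [← e] at h3
  nlinarith

theorem Curve.low_side (h : Curve γ a) : ∃ c η B : ℝ, 0 < c ∧ 0 < η ∧ 0 < B ∧ ∀ t₀ t y : ℝ,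
    |t - t₀| ≤ η → |y| ≤ η → y ≠ 0 → Low γ c B (γ t + y * (I * deriv γ t₀)) t |y| := by
  obtain ⟨c, η, hc, hη, -, H⟩ := h.trans
  obtain ⟨M, hM, hM'⟩ := per_bdd h.perd h.contd
  refine ⟨c, η, M, hc, hη, hM, fun t₀ t y ht hy hy0 => ⟨abs_pos.2 hy0, ?_, fun x hx => H t₀ t y x ht hy hx⟩⟩
  have := hM' t₀
  simp
  rw [mul_comm]; gcongr

theorem shift_half (h : Curve γ a) (s : ℝ) {z : ℂ} (P : ∀ x : ℝ, |x| ≤ 1/2 → γ (s + x) ≠ z) : z ∉ range γ := by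
  rintro ⟨t, rfl⟩
  have hp := (h.per.int_mul (-round (t - s))) t
  apply P (t - s - round (t - s)) (abs_sub_round _)
  rw [← hp]; congr 1; push_cast; ring

theorem Low.notMem (h : Curve γ a) {c B : ℝ} {z : ℂ} {s d : ℝ} (hc : 0 < c) (hl : Low γ c B z s d) : z ∉ range γ := by
  apply shift_half h s
  intro x hx e
  have := hl.low x hx
  rw [e, sub_self, norm_zero] at this
  have := hl.dpos
  have : 0 < c * (|x| + d) := by positivity
  linarith

/-- The basic kernel. -/
def kk (a δ x : ℝ) : ℝ := |x| ^ (a - 1) * (δ / (|x| + δ))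

theorem kk_nonneg {a δ x : ℝ} (hδ : 0 < δ) : 0 ≤ kk a δ x := by unfold kk; positivity

theorem kk1_int (ha : 0 < a) (ha1 : a < 1) : Integrable (kk a 1) := by
  have hm : Measurable (kk a 1) := by unfold kk; fun_prop
  have hI : IntegrableOn (kk a 1) (Ioi 0) := by
    rw [← Ioc_union_Ioi_eq_Ioi zero_le_one]
    refine IntegrableOn.union ?_ ?_
    · have := intervalIntegral.intervalIntegrable_rpow' (a := 0) (b := 1) (r := a - 1) (by linarith)
      rw [intervalIntegrable_iff_integrableOn_Ioc_of_le zero_le_one] at this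
      refine Integrable.mono' this hm.aestronglyMeasurable ?_
      filter_upwards [ae_restrict_mem measurableSet_Ioc] with x hx
      rw [Real.norm_of_nonneg (kk_nonneg one_pos), kk, abs_of_pos hx.1]
      have : (0:ℝ) ≤ x ^ (a-1) := Real.rpow_nonneg hx.1.le _
      refine mul_le_of_le_one_right this ?_
      rw [div_le_one (by linarith [hx.1])]; linarith [hx.1]
    · have := integrableOn_Ioi_rpow_of_lt (a := a - 2) (c := 1) (by linarith) one_pos
      refine Integrable.mono' this hm.aestronglyMeasurable ?_
      filter_upwards [ae_restrict_mem measurableSet_Ioi] with x hx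
      have hx0 : 0 < x := one_pos.trans hx
      rw [Real.norm_of_nonneg (kk_nonneg one_pos), kk, abs_of_pos hx0,
        show a - 2 = (a - 1) + (-1) by ring, Real.rpow_add hx0 (a-1) (-1), Real.rpow_neg_one, ← one_div x]
      gcongr
      linarith
  have hI' : IntegrableOn (kk a 1) (Iic 0) := by
    have := (integrableOn_Ici_iff_integrableOn_Ioi (by simp)).2 hI
    have h2 := ((Measure.measurePreserving_neg (volume : Measure ℝ)).integrableOn_comp_preimage
      (Homeomorph.neg ℝ).measurableEmbedding).2 this
    have e : (kk a 1 ∘ Neg.neg) = kk a 1 := by ext x; simp [kk]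
    rw [e] at h2
    simpa using h2
  rw [← integrableOn_univ, ← Iic_union_Ioi (a := (0:ℝ))]
  exact hI'.union hI

theorem kk_scale {δ : ℝ} (hδ : 0 < δ) (x : ℝ) :
    kk a δ x = δ ^ (a - 1) * kk a 1 (δ⁻¹ * x) := by
  unfold kk
  have h1 : |δ⁻¹ * x| = |x| / δ := by
    rw [abs_mul, abs_of_pos (inv_pos.2 hδ)]; ring
  rw [h1, Real.div_rpow (abs_nonneg _) hδ.le]
  have := (Real.rpow_pos_of_pos hδ (a-1)).ne'
  have : |x| + δ ≠ 0 := by positivity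
  have : |x| / δ + 1 ≠ 0 := by positivity
  field_simp

theorem kk_bound (ha : 0 < a) (ha1 : a < 1) : ∃ A : ℝ, 0 ≤ A ∧ ∀ δ > 0,
    IntervalIntegrable (kk a δ) volume (-(1/2)) (1/2) ∧ ∫ x in (-(1/2):ℝ)..(1/2), kk a δ x ≤ A * δ ^ a := by
  refine ⟨∫ x, kk a 1 x, integral_nonneg fun x => kk_nonneg one_pos, fun δ hδ => ?_⟩
  have hI : Integrable (kk a δ) := by
    rw [show kk a δ = fun x => δ ^ (a - 1) * kk a 1 (δ⁻¹ * x) from funext (kk_scale hδ)]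
    exact ((kk1_int ha ha1).comp_mul_left' (inv_pos.2 hδ).ne').const_mul _
  refine ⟨hI.intervalIntegrable, ?_⟩
  rw [intervalIntegral.integral_of_le (by norm_num)]
  refine (setIntegral_le_integral hI (ae_of_all _ fun x => kk_nonneg hδ)).trans ?_
  rw [show kk a δ = fun x => δ ^ (a - 1) * kk a 1 (δ⁻¹ * x) from funext (kk_scale hδ),
    integral_const_mul, Measure.integral_comp_mul_left]
  rw [inv_inv, abs_of_pos hδ, smul_eq_mul, ← mul_assoc, mul_comm]
  rw [← Real.rpow_add_one hδ.ne', sub_add_cancel]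

end CKA

namespace CKA

variable {γ : ℝ → ℂ} {a : ℝ}

/-- The constant `1/(2πi)`. -/
def w0 : ℂ := (2 * Real.pi * I)⁻¹

theorem w0_ne : w0 ≠ 0 := by simp [w0, Real.pi_ne_zero]

/-- The Cauchy integral. -/
def Cau (γ f : ℝ → ℂ) (z : ℂ) : ℂ := w0 * ∫ t in (0:ℝ)..1, f t * deriv γ t / (γ t - z)

/-- The derivative of the Cauchy integral. -/
def Cau2 (γ f : ℝ → ℂ) (z : ℂ) : ℂ := w0 * ∫ t in (0:ℝ)..1, f t * deriv γ t / (γ t - z) ^ 2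

/-- The regularized Cauchy integral. -/
def VV (γ f : ℝ → ℂ) (z : ℂ) (s : ℝ) : ℂ :=
  w0 * ∫ x in (-(1/2):ℝ)..(1/2), (f (s + x) - f s) * deriv γ (s + x) / (γ (s + x) - z)

theorem per_shift {g : ℝ → ℂ} (hg : Function.Periodic g 1) (s : ℝ) :
    ∫ t in (0:ℝ)..1, g t = ∫ x in (-(1/2):ℝ)..(1/2), g (s + x) := by
  have := hg.intervalIntegral_add_eq 0 (s - 1/2)
  rw [zero_add] at this
  rw [this, intervalIntegral.integral_comp_add_left]
  congr 1 <;> ring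

theorem sub_ne {z : ℂ} (hz : z ∉ range γ) (t : ℝ) : γ t - z ≠ 0 :=
  sub_ne_zero.2 fun e => hz ⟨t, e⟩

theorem cont_integrand (h : Curve γ a) {f : ℝ → ℂ} (hf : Continuous f) {z : ℂ} (hz : z ∉ range γ) (n : ℕ) :
    Continuous fun t => f t * deriv γ t / (γ t - z) ^ n :=
  (hf.mul h.contd).div ((h.cont.sub continuous_const).pow n) fun t => pow_ne_zero _ (sub_ne hz t)

theorem cau_deriv (h : Curve γ a) {f : ℝ → ℂ} (hf : Continuous f) {z : ℂ} (hz : z ∉ range γ) :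
    HasDerivAt (Cau γ f) (Cau2 γ f z) z := by
  have hd : 0 < infDist z (range γ) :=
    (h.compact.isClosed.notMem_iff_infDist_pos (range_nonempty γ)).1 hz
  set d := infDist z (range γ)
  have hnot : ∀ w ∈ ball z (d/2), ∀ t, d / 2 ≤ ‖γ t - w‖ := by
    intro w hw t
    have h1 : d ≤ dist z (γ t) := infDist_le_dist_of_mem (mem_range_self t)
    rw [mem_ball] at hw
    have := dist_triangle z w (γ t)
    rw [← dist_eq_norm, dist_comm (γ t)]
    rw [dist_comm w] at hw
    linarith
  have hnot' : ∀ w ∈ ball z (d/2), w ∉ range γ := by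
    rintro w hw ⟨t, rfl⟩
    have := hnot _ hw t
    simp at this; linarith
  have hfg : Continuous fun t => f t * deriv γ t := hf.mul h.contd
  have := (intervalIntegral.hasDerivAt_integral_of_dominated_loc_of_deriv_le (μ := volume)
    (a := 0) (b := 1) (𝕜 := ℂ)
    (F := fun w t => f t * deriv γ t / (γ t - w)) (F' := fun w t => f t * deriv γ t / (γ t - w) ^ 2)
    (x₀ := z) (s := ball z (d/2)) (bound := fun t => ‖f t * deriv γ t‖ / (d/2) ^ 2)
    (ball_mem_nhds _ (by positivity)) ?_ ?_ ?_ ?_ ?_ ?_).2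
  · exact this.const_mul w0
  · filter_upwards [ball_mem_nhds z (half_pos hd)] with w hw
    simpa using (cont_integrand h hf (hnot' w hw) 1).aestronglyMeasurable
  · simpa using (cont_integrand h hf hz 1).intervalIntegrable 0 1
  · exact (cont_integrand h hf hz 2).aestronglyMeasurable
  · refine ae_of_all _ fun t _ w hw => ?_
    rw [norm_div, norm_pow]
    gcongr
    exact hnot w hw t
  · exact (hfg.norm.div_const _).intervalIntegrable _ _
  · refine ae_of_all _ fun t _ w hw => ?_
    have hne := sub_ne (hnot' w hw) t
    have h1 : HasDerivAt (fun w => γ t - w) (-1) w := by simpa using (hasDerivAt_id w).const_sub (γ t)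
    have h2 := (hasDerivAt_const w (f t * deriv γ t)).div h1 hne
    exact h2.congr_deriv (by simp)

theorem cau_parts (h : Curve γ a) {f : ℝ → ℂ} (hp : Function.Periodic f 1) (hf : Differentiable ℝ f)
    (hf' : Continuous (deriv f)) {z : ℂ} (hz : z ∉ range γ) :
    Cau2 γ f z = Cau γ (fun t => deriv f t * (deriv γ t)⁻¹) z := by
  unfold Cau2 Cau
  congr 1
  have e : ∀ t, deriv f t * (deriv γ t)⁻¹ * deriv γ t / (γ t - z) = deriv f t / (γ t - z) := fun t => by
    rw [mul_assoc, inv_mul_cancel₀ (h.ne t), mul_one]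
  simp_rw [e]
  have c1 : Continuous fun t => deriv f t / (γ t - z) :=
    hf'.div (h.cont.sub continuous_const) (sub_ne hz)
  have c2 := cont_integrand h hf.continuous hz 2
  have hd : ∀ t ∈ uIcc (0:ℝ) 1, HasDerivAt (fun t => f t / (γ t - z))
      (deriv f t / (γ t - z) - f t * deriv γ t / (γ t - z) ^ 2) t := by
    intro t _
    have hne := sub_ne hz t
    refine ((hf t).hasDerivAt.div ((h.hd t).sub_const z) hne).congr_deriv ?_
    field_simp
  have := intervalIntegral.integral_eq_sub_of_hasDerivAt hd ((c1.sub c2).intervalIntegrable _ _)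
  rw [intervalIntegral.integral_sub (c1.intervalIntegrable _ _) (c2.intervalIntegrable _ _)] at this
  have e1 : f 1 = f 0 := by simpa using hp 0
  have e2 : γ 1 = γ 0 := by simpa using h.per 0
  rw [e1, e2, sub_self, sub_eq_zero] at this
  exact this.symm

theorem cau_hasDeriv (h : Curve γ a) {f : ℝ → ℂ} (hf : CH a 1 f) {z : ℂ} (hz : z ∉ range γ) :
    HasDerivAt (Cau γ f) (Cau γ (fun t => deriv f t * (deriv γ t)⁻¹) z) z := by
  rw [← cau_parts h hf.per hf.2.1 (hf.2.2.cont h.ha) hz]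
  exact cau_deriv h (hf.cont h.ha) hz

theorem cau2_one (h : Curve γ a) {z : ℂ} (hz : z ∉ range γ) : Cau2 γ (fun _ => 1) z = 0 := by
  rw [cau_parts h (fun _ => rfl) (differentiable_const _) (by simp [continuous_const]) hz]
  simp [Cau]

/-- winding number -/
def Ind (γ : ℝ → ℂ) (z : ℂ) : ℂ := Cau γ (fun _ => 1) z

theorem ind_deriv (h : Curve γ a) {z : ℂ} (hz : z ∉ range γ) : HasDerivAt (Ind γ) 0 z := by
  rw [← cau2_one h hz]
  exact cau_deriv h continuous_const hz

theorem per_integrand (h : Curve γ a) {f : ℝ → ℂ} (hp : Function.Periodic f 1) (z : ℂ) (n : ℕ) :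
    Function.Periodic (fun t => f t * deriv γ t / (γ t - z) ^ n) 1 := by
  intro t
  simp only [hp t, h.per t, h.perd t]

theorem cau_eq (h : Curve γ a) {f : ℝ → ℂ} (hp : Function.Periodic f 1) (hf : Continuous f)
    {z : ℂ} (hz : z ∉ range γ) (s : ℝ) :
    Cau γ f z = f s * Ind γ z + VV γ f z s := by
  unfold Ind VV Cau
  have p1 := per_shift (per_integrand h hp z 1) s
  have p2 := per_shift (per_integrand h (f := fun _ => 1) (fun _ => rfl) z 1) s
  have c1 : Continuous fun t => f t * deriv γ t / (γ t - z) := by simpa using cont_integrand h hf hz 1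
  have c2 : Continuous fun t => (1:ℂ) * deriv γ t / (γ t - z) := by
    simpa using cont_integrand h (continuous_const (y := 1)) hz 1
  have c3 : Continuous fun x : ℝ => s + x := by fun_prop
  simp only [one_mul, pow_one] at *
  rw [p1, p2, mul_left_comm, ← mul_add]
  congr 1
  rw [← intervalIntegral.integral_const_mul, ← intervalIntegral.integral_add]
  · congr 1; ext x; ring
  · exact (continuous_const.mul (c2.comp c3)).intervalIntegrable _ _
  · have := ((c1.comp c3).sub (continuous_const (y := f s) |>.mul (c2.comp c3))).intervalIntegrable
      (μ := volume) (-(1/2)) (1/2)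
    refine this.congr (fun x _ => ?_)
    change f (s + x) * deriv γ (s + x) / (γ (s + x) - z) - f s * (deriv γ (s + x) / (γ (s + x) - z)) = _
    ring

theorem cau2_eq (h : Curve γ a) {f : ℝ → ℂ} (hp : Function.Periodic f 1) (hf : Continuous f)
    {z : ℂ} (hz : z ∉ range γ) (s : ℝ) :
    Cau2 γ f z = w0 * ∫ x in (-(1/2):ℝ)..(1/2), (f (s + x) - f s) * deriv γ (s + x) / (γ (s + x) - z) ^ 2 := by
  have h0 := cau2_one h hz
  unfold Cau2 at *
  have p1 := per_shift (per_integrand h hp z 2) s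
  have p2 := per_shift (per_integrand h (f := fun _ => 1) (fun _ => rfl) z 2) s
  have c1 := cont_integrand h hf hz 2
  have c2 := cont_integrand h (continuous_const (y := 1)) hz 2
  have c3 : Continuous fun x : ℝ => s + x := by fun_prop
  have h1 := (mul_eq_zero.1 h0).resolve_left w0_ne
  rw [p2] at h1
  rw [p1]
  congr 1
  rw [← sub_zero (∫ x in _.._, f (s + x) * deriv γ (s + x) / _), ← mul_zero (f s), ← h1,
    ← intervalIntegral.integral_const_mul, ← intervalIntegral.integral_sub]
  · congr 1; ext x; ring
  · exact (c1.comp c3).intervalIntegrable _ _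
  · exact (continuous_const.mul (c2.comp c3)).intervalIntegrable _ _

theorem rpow_split {x : ℝ} (ha : 0 < a) : |x| ^ a = |x| ^ (a - 1) * |x| := by
  rcases eq_or_ne x 0 with rfl | hx
  · simp [Real.zero_rpow ha.ne']
  · rw [← Real.rpow_add_one (abs_pos.2 hx).ne', sub_add_cancel]

theorem vv_bound_int (h : Curve γ a) {f : ℝ → ℂ} (hf : CH a 0 f) (s : ℝ) :
    IntervalIntegrable (fun x => (f (s + x) - f s) * deriv γ (s + x) / (γ (s + x) - γ s)) volume
      (-(1/2)) (1/2) := by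
  obtain ⟨C, hC, hC'⟩ := hf.2
  obtain ⟨M, hM, hM'⟩ := per_bdd h.perd h.contd
  obtain ⟨c, hc, hc'⟩ := h.chord
  obtain ⟨A, hA, hA'⟩ := kk_bound h.ha h.ha1
  have hI := ((hA' 1 one_pos).1.const_mul (C * M / c * (3/2)))
  refine hI.mono_fun' ?_ ?_
  · have := hf.cont h.ha
    have c1 := h.cont
    have c2 := h.contd
    have m1 : Measurable fun x => (f (s + x) - f s) * deriv γ (s + x) := by
      apply Continuous.measurable; fun_prop
    have m2 : Measurable fun x => γ (s + x) - γ s := by apply Continuous.measurable; fun_prop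
    exact (m1.div m2).aestronglyMeasurable
  · filter_upwards [ae_restrict_mem measurableSet_uIoc] with x hx
    rw [uIoc_of_le (by norm_num)] at hx
    have hx' : |x| ≤ 1/2 := abs_le.2 ⟨hx.1.le, hx.2⟩
    rcases eq_or_ne x 0 with rfl | hx0
    · simp only [add_zero, sub_self, zero_mul, zero_div, norm_zero]
      have := kk_nonneg (a := a) (x := 0) one_pos
      positivity
    have hxp : 0 < |x| := abs_pos.2 hx0
    have h1 := hC' (s + x) s
    rw [add_sub_cancel_left] at h1
    have hp : (0:ℝ) ≤ |x| ^ (a - 1) := by positivity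
    calc _ = ‖f (s + x) - f s‖ * ‖deriv γ (s + x)‖ / ‖γ (s + x) - γ s‖ := by rw [norm_div, norm_mul]
      _ ≤ (C * |x| ^ a) * M / (c * |x|) := by
        gcongr
        exacts [hM' _, hc' _ _ hx']
      _ = C * M / c * |x| ^ (a - 1) := by rw [rpow_split h.ha]; field_simp
      _ ≤ C * M / c * ((3/2) * kk a 1 x) := by
        gcongr
        have : (2/3:ℝ) ≤ 1 / (|x| + 1) := by rw [le_div_iff₀ (by positivity)]; linarith
        unfold kk
        nlinarith
      _ = _ := by ring

theorem est_b (h : Curve γ a) {f : ℝ → ℂ} (hf : CH a 0 f) {c B : ℝ} (hc : 0 < c) (hB : 0 < B) :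
    ∃ K : ℝ, 0 ≤ K ∧ ∀ z s d, Low γ c B z s d → ‖VV γ f z s - VV γ f (γ s) s‖ ≤ K * d ^ a := by
  obtain ⟨C, hC, hC'⟩ := hf.2
  obtain ⟨M, hM, hM'⟩ := per_bdd h.perd h.contd
  obtain ⟨c0, hc0, hc0'⟩ := h.chord
  obtain ⟨A, hA, hA'⟩ := kk_bound h.ha h.ha1
  refine ⟨‖w0‖ * ((C * M * B / (c * c0)) * A), by positivity, fun z s d hl => ?_⟩
  have hd := hl.dpos
  have hz := hl.notMem h hc
  have hfc := hf.cont h.ha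
  have c3 : Continuous fun x : ℝ => s + x := by fun_prop
  have cI : Continuous fun x => (f (s + x) - f s) * deriv γ (s + x) / (γ (s + x) - z) := by
    have := cont_integrand h (f := fun t => f t - f s) (hfc.sub continuous_const) hz 1
    simpa [Function.comp_def] using this.comp c3
  unfold VV
  rw [← mul_sub, norm_mul, ← intervalIntegral.integral_sub (cI.intervalIntegrable _ _) (vv_bound_int h hf s),
    mul_assoc]
  gcongr
  have hI := (hA' d hd).1.const_mul (C * M * B / (c * c0))
  calc _ ≤ ∫ x in (-(1/2):ℝ)..(1/2), C * M * B / (c * c0) * kk a d x := by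
        refine intervalIntegral.norm_integral_le_of_norm_le (by norm_num) (ae_of_all _ fun x hx => ?_) hI
        have hx' : |x| ≤ 1/2 := abs_le.2 ⟨hx.1.le, hx.2⟩
        rcases eq_or_ne x 0 with rfl | hx0
        · simp only [add_zero, sub_self, zero_mul, zero_div, norm_zero]
          have := kk_nonneg (a := a) (x := 0) hd
          positivity
        have hxp : 0 < |x| := abs_pos.2 hx0
        have h1 := hC' (s + x) s
        rw [add_sub_cancel_left] at h1
        have hl1 := hl.low x hx'
        have hch := hc0' s x hx'
        have n1 : γ (s + x) - z ≠ 0 := sub_ne hz _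
        have n2 : γ (s + x) - γ s ≠ 0 := by
          rw [← norm_pos_iff]; exact lt_of_lt_of_le (by positivity) hch
        have hp : (0:ℝ) ≤ |x| ^ (a - 1) := by positivity
        calc _ = ‖(f (s + x) - f s) * deriv γ (s + x) * (z - γ s) / ((γ (s + x) - z) * (γ (s + x) - γ s))‖ := by
              congr 1; field_simp; ring
          _ = ‖f (s + x) - f s‖ * ‖deriv γ (s + x)‖ * ‖z - γ s‖ / (‖γ (s + x) - z‖ * ‖γ (s + x) - γ s‖) := by
              simp only [norm_div, norm_mul]
          _ ≤ (C * |x| ^ a) * M * (B * d) / ((c * (|x| + d)) * (c0 * |x|)) := by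
            gcongr
            exacts [hM' _, hl.close]
          _ = _ := by
            rw [rpow_split h.ha, kk]
            field_simp
    _ = C * M * B / (c * c0) * ∫ x in (-(1/2):ℝ)..(1/2), kk a d x := by
      rw [intervalIntegral.integral_const_mul]
    _ ≤ C * M * B / (c * c0) * (A * d ^ a) := by gcongr; exact (hA' d hd).2
    _ = _ := by ring

theorem est_g (h : Curve γ a) {f : ℝ → ℂ} (hf : CH a 0 f) {c B : ℝ} (hc : 0 < c) :
    ∃ K : ℝ, 0 ≤ K ∧ ∀ z s d, Low γ c B z s d → ‖Cau2 γ f z‖ ≤ K * d ^ (a - 1) := by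
  obtain ⟨C, hC, hC'⟩ := hf.2
  obtain ⟨M, hM, hM'⟩ := per_bdd h.perd h.contd
  obtain ⟨A, hA, hA'⟩ := kk_bound h.ha h.ha1
  refine ⟨‖w0‖ * ((C * M / (c * c)) * A), by positivity, fun z s d hl => ?_⟩
  have hd := hl.dpos
  have hz := hl.notMem h hc
  have hfc := hf.cont h.ha
  rw [cau2_eq h hf.per hfc hz s, norm_mul, mul_assoc]
  gcongr
  have hI := (hA' d hd).1.const_mul (C * M / (c * c) / d)
  calc _ ≤ ∫ x in (-(1/2):ℝ)..(1/2), C * M / (c * c) / d * kk a d x := by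
        refine intervalIntegral.norm_integral_le_of_norm_le (by norm_num) (ae_of_all _ fun x hx => ?_) hI
        have hx' : |x| ≤ 1/2 := abs_le.2 ⟨hx.1.le, hx.2⟩
        rcases eq_or_ne x 0 with rfl | hx0
        · simp only [add_zero, sub_self, zero_mul, zero_div, norm_zero]
          have := kk_nonneg (a := a) (x := 0) hd
          positivity
        have hxp : 0 < |x| := abs_pos.2 hx0
        have h1 := hC' (s + x) s
        rw [add_sub_cancel_left] at h1
        have hl1 := hl.low x hx'
        have hp : (0:ℝ) ≤ |x| ^ (a - 1) := by positivity
        have hl2 : (c * |x|) * (c * (|x| + d)) ≤ ‖γ (s + x) - z‖ ^ 2 := by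
          rw [pow_two]
          gcongr
          refine le_trans ?_ hl1
          gcongr; linarith
        calc _ = ‖f (s + x) - f s‖ * ‖deriv γ (s + x)‖ / ‖γ (s + x) - z‖ ^ 2 := by
              simp only [norm_div, norm_mul, norm_pow]
          _ ≤ (C * |x| ^ a) * M / ((c * |x|) * (c * (|x| + d))) := by
            gcongr
            exacts [hM' _]
          _ = _ := by
            rw [rpow_split h.ha, kk]
            field_simp
    _ = C * M / (c * c) / d * ∫ x in (-(1/2):ℝ)..(1/2), kk a d x := by
      rw [intervalIntegral.integral_const_mul]
    _ ≤ C * M / (c * c) / d * (A * d ^ a) := by gcongr; exact (hA' d hd).2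
    _ = _ := by rw [Real.rpow_sub_one hd.ne']; field_simp

theorem cau_infty (h : Curve γ a) {f : ℝ → ℂ} (hf : Continuous f) (hp : Function.Periodic f 1) :
    Tendsto (Cau γ f) (cocompact ℂ) (𝓝 0) := by
  obtain ⟨M, hM, hM'⟩ := per_bdd h.perd h.contd
  obtain ⟨N, hN, hN'⟩ := per_bdd hp hf
  obtain ⟨R, hR, hR'⟩ := per_bdd h.per h.cont
  rw [tendsto_zero_iff_norm_tendsto_zero]
  have hg : Tendsto (fun z : ℂ => ‖w0‖ * (N * M / (‖z‖ - R))) (cocompact ℂ) (𝓝 0) := by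
    rw [← mul_zero ‖w0‖]
    refine Tendsto.const_mul _ (Tendsto.div_atTop tendsto_const_nhds ?_)
    exact tendsto_atTop_add_const_right _ _ (tendsto_norm_cocompact_atTop (E := ℂ))
  refine squeeze_zero' (Eventually.of_forall fun _ => norm_nonneg _) ?_ hg
  filter_upwards [(tendsto_norm_cocompact_atTop (E := ℂ)).eventually_gt_atTop R] with z hz
  unfold Cau
  rw [norm_mul]
  gcongr
  refine (intervalIntegral.norm_integral_le_of_norm_le_const (C := N * M / (‖z‖ - R)) fun t _ => ?_).trans (by simp)
  rw [norm_div, norm_mul]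
  have : ‖z‖ - R ≤ ‖γ t - z‖ := by
    have := norm_sub_norm_le z (γ t)
    rw [norm_sub_rev]; linarith [hR' t]
  have : 0 < ‖z‖ - R := by linarith
  gcongr
  exacts [hN' t, hM' t]

end CKA

namespace CKA

variable {γ : ℝ → ℂ} {a : ℝ}

theorem taylor1 {C : ℝ} (h : Curve γ a) (hC : 0 ≤ C)
    (hC' : ∀ s t, ‖deriv γ s - deriv γ t‖ ≤ C * |s - t| ^ a) (t x : ℝ) :
    ‖γ (t + x) - γ t - x * deriv γ t‖ ≤ C * |x| ^ a * |x| := by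
  have := Convex.norm_image_sub_le_of_norm_hasDerivWithin_le (𝕜 := ℝ)
    (f := fun r : ℝ => γ r - r * deriv γ t)
    (f' := fun r => deriv γ r - deriv γ t) (s := Icc (t - |x|) (t + |x|)) (C := C * |x| ^ a)
    (x := t) (y := t + x) ?_ ?_ (convex_Icc _ _) ?_ ?_
  · rw [add_sub_cancel_left, Real.norm_eq_abs] at this
    have e : γ (t + x) - γ t - x * deriv γ t =
        (γ (t + x) - ((t + x : ℝ) : ℂ) * deriv γ t) - (γ t - (t:ℂ) * deriv γ t) := by
      push_cast; ring
    rw [e]; exact this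
  · intro r _
    have : HasDerivAt (fun r : ℝ => (r:ℂ) * deriv γ t) (1 * deriv γ t) r :=
      (hasDerivAt_id r).ofReal_comp.mul_const _
    exact (((h.hd r).sub this).congr_deriv (by rw [one_mul])).hasDerivWithinAt
  · intro r hr
    refine (hC' r t).trans ?_
    have : |r - t| ≤ |x| := abs_le.2 ⟨by linarith [hr.1], by linarith [hr.2]⟩
    have := Real.rpow_le_rpow (abs_nonneg _) this h.ha.le
    gcongr
  · constructor <;> linarith [abs_nonneg x]
  · constructor <;> linarith [neg_abs_le x, le_abs_self x]

/-- Remainder of the Cauchy kernel against the straight line kernel. -/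
def RR (γ : ℝ → ℂ) (t₀ y x : ℝ) : ℂ :=
  deriv γ (t₀ + x) / (γ (t₀ + x) - (γ t₀ + y * (I * deriv γ t₀))) - 1 / (x - y * I)

theorem norm_xy (x y : ℝ) : (|x| + |y|) / 2 ≤ ‖(x:ℂ) - y * I‖ := by
  have h1 := Complex.abs_re_le_norm ((x:ℂ) - y * I)
  have h2 := Complex.abs_im_le_norm ((x:ℂ) - y * I)
  simp at h1 h2
  linarith

theorem rr_bound (h : Curve γ a) : ∃ K η : ℝ, 0 ≤ K ∧ 0 < η ∧ ∀ t₀ y x : ℝ, |y| ≤ η → |x| ≤ 1/2 → x ≠ 0 →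
    ‖RR γ t₀ y x‖ ≤ K * |x| ^ (a - 1) := by
  obtain ⟨C, hC, hC'⟩ := h.hol
  obtain ⟨c, η, hc, hη, -, H⟩ := h.trans
  refine ⟨4 * C / c, η, by positivity, hη, fun t₀ y x hy hx hx0 => ?_⟩
  have hxp := abs_pos.2 hx0
  have h1 := H t₀ t₀ y x (by simp [hη.le]) hy hx
  set g := deriv γ t₀
  have h2 := norm_xy x y
  have n1 : γ (t₀ + x) - (γ t₀ + y * (I * g)) ≠ 0 := by
    rw [← norm_pos_iff]; exact lt_of_lt_of_le (by positivity) h1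
  have n2 : (x:ℂ) - y * I ≠ 0 := by
    rw [← norm_pos_iff]; exact lt_of_lt_of_le (by positivity) h2
  have e : RR γ t₀ y x = ((deriv γ (t₀ + x) - g) * (x - y * I) - (γ (t₀ + x) - γ t₀ - x * g)) /
      ((γ (t₀ + x) - (γ t₀ + y * (I * g))) * (x - y * I)) := by
    unfold RR
    rw [div_sub_div _ _ n1 n2]
    congr 1; ring
  rw [e, norm_div, norm_mul]
  have h3 : ‖(deriv γ (t₀ + x) - g) * (x - y * I) - (γ (t₀ + x) - γ t₀ - x * g)‖ ≤
      2 * C * |x| ^ a * (|x| + |y|) := by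
    refine (norm_sub_le _ _).trans ?_
    have e1 := hC' (t₀ + x) t₀
    rw [add_sub_cancel_left] at e1
    have e2 := taylor1 h hC hC' t₀ x
    have e3 : ‖(x:ℂ) - y * I‖ ≤ |x| + |y| := (norm_sub_le _ _).trans (by simp)
    rw [norm_mul]
    have e4 : ‖deriv γ (t₀ + x) - g‖ * ‖(x:ℂ) - y * I‖ ≤ (C * |x| ^ a) * (|x| + |y|) := by gcongr
    have e5 : C * |x| ^ a * |x| ≤ C * |x| ^ a * (|x| + |y|) := by
      gcongr; linarith [abs_nonneg y]
    linarith
  calc _ ≤ 2 * C * |x| ^ a * (|x| + |y|) / (c * (|x| + |y|) * (|x| / 2)) := by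
        gcongr
        linarith [abs_nonneg y]
    _ = _ := by
      rw [rpow_split h.ha]
      have : |x| + |y| ≠ 0 := by positivity
      field_simp
      ring

theorem line_int {y : ℝ} (hy : 0 < y) :
    ∫ x in (-(1/2):ℝ)..(1/2), ((1:ℂ) / (x - y * I) - 1 / (x - (-y:ℝ) * I)) =
      ((4 * Real.arctan (1 / (2 * y)) : ℝ) : ℂ) * I := by
  have hne : ∀ x y : ℝ, y ≠ 0 → (x:ℂ) - y * I ≠ 0 := by
    intro x y hy e
    have := congrArg Complex.im e
    simp at this; exact hy this
  have e : ∀ x : ℝ, (1:ℂ) / (x - y * I) - 1 / (x - (-y:ℝ) * I) = ((2 * (1 / (1 + (x/y)^2) * (1/y)) : ℝ):ℂ) * I := by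
    intro x
    have n1 := hne x y hy.ne'
    have n2 := hne x (-y) (by linarith)
    have n3 : ((y:ℂ)^2 + x^2) ≠ 0 := by
      have : (0:ℝ) < y^2 + x^2 := by positivity
      exact_mod_cast this.ne'
    have n4 : (1 + (x/y:ℂ)^2) ≠ 0 := by
      have : (0:ℝ) < 1 + (x/y)^2 := by positivity
      exact_mod_cast this.ne'
    have n5 : (y:ℂ) ≠ 0 := by exact_mod_cast hy.ne'
    rw [div_sub_div _ _ n1 n2, div_eq_iff (mul_ne_zero n1 n2)]
    push_cast
    field_simp
    ring_nf
    simp only [Complex.I_sq, show Complex.I ^ 3 = -Complex.I by rw [pow_succ, Complex.I_sq]; ring]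
    ring
  simp_rw [e]
  rw [intervalIntegral.integral_mul_const, intervalIntegral.integral_ofReal]
  congr 2
  have hd : ∀ x ∈ uIcc (-(1/2):ℝ) (1/2), HasDerivAt (fun x => 2 * Real.arctan (x / y))
      (2 * (1 / (1 + (x/y)^2) * (1/y))) x := by
    intro x _
    have := ((hasDerivAt_id x).div_const y).arctan.const_mul 2
    simpa using this
  rw [intervalIntegral.integral_eq_sub_of_hasDerivAt hd]
  · rw [show -(1/2) / y = -(1 / (2 * y)) by ring, Real.arctan_neg, show 1/2/y = 1/(2*y) by ring]; ring
  · apply Continuous.intervalIntegrable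
    have : ∀ x : ℝ, 1 + (x/y)^2 ≠ 0 := fun x => by positivity
    fun_prop (disch := assumption)

theorem jump (h : Curve γ a) (t₀ : ℝ) :
    Tendsto (fun y : ℝ => Ind γ (γ t₀ + y * (I * deriv γ t₀)) - Ind γ (γ t₀ + (-y:ℝ) * (I * deriv γ t₀)))
      (𝓝[>] 0) (𝓝 1) := by
  obtain ⟨K, η, hK, hη, hR⟩ := rr_bound h
  obtain ⟨c, η', B, hc, hη', hB, hL⟩ := h.low_side
  set g := deriv γ t₀ with hg
  obtain ⟨A, hA, hA'⟩ := kk_bound h.ha h.ha1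
  have hsm : ∀ᶠ y : ℝ in 𝓝[>] 0, 0 < y ∧ y ≤ η ∧ y ≤ η' := by
    have h1 : Ioc (0:ℝ) (min η η') ∈ 𝓝[>] (0:ℝ) := Ioc_mem_nhdsGT (lt_min hη hη')
    filter_upwards [h1] with y hy
    exact ⟨hy.1, hy.2.trans (min_le_left _ _), hy.2.trans (min_le_right _ _)⟩
  have hmeas : ∀ y, Measurable (RR γ t₀ y) := by
    intro y
    have c1 := h.cont
    have c2 := h.contd
    unfold RR
    refine Measurable.sub (Measurable.div ?_ ?_) (Measurable.div ?_ ?_)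
    all_goals (apply Continuous.measurable; fun_prop)
  have hlim : Tendsto (fun y : ℝ => ∫ x in (-(1/2):ℝ)..(1/2), (RR γ t₀ y x - RR γ t₀ (-y) x)) (𝓝[>] 0)
      (𝓝 (∫ x in (-(1/2):ℝ)..(1/2), (0:ℂ))) := by
    refine intervalIntegral.tendsto_integral_filter_of_dominated_convergence
      (fun x => 2 * K * (3/2) * kk a 1 x) ?_ ?_ ?_ ?_
    · exact Eventually.of_forall fun y => ((hmeas y).sub (hmeas (-y))).aestronglyMeasurable
    · filter_upwards [hsm] with y hy
      have : ∀ᵐ x : ℝ, x ≠ 0 := Measure.ae_ne volume 0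
      filter_upwards [this] with x hx0 hx
      rw [uIoc_of_le (by norm_num)] at hx
      have hx' : |x| ≤ 1/2 := abs_le.2 ⟨hx.1.le, hx.2⟩
      have b1 := hR t₀ y x (by rw [abs_of_pos hy.1]; exact hy.2.1) hx' hx0
      have b2 := hR t₀ (-y) x (by rw [abs_neg, abs_of_pos hy.1]; exact hy.2.1) hx' hx0
      have hp : (0:ℝ) ≤ |x| ^ (a - 1) := by positivity
      have b3 : |x| ^ (a - 1) ≤ (3/2) * kk a 1 x := by
        have : (2/3:ℝ) ≤ 1 / (|x| + 1) := by rw [le_div_iff₀ (by positivity)]; linarith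
        unfold kk
        nlinarith
      have b4 := mul_le_mul_of_nonneg_left b3 hK
      refine (norm_sub_le _ _).trans ?_
      linarith
    · exact (hA' 1 one_pos).1.const_mul _
    · have : ∀ᵐ x : ℝ, x ≠ 0 := Measure.ae_ne volume 0
      filter_upwards [this] with x hx0 hx
      rw [uIoc_of_le (by norm_num)] at hx
      have hx' : |x| ≤ 1/2 := abs_le.2 ⟨hx.1.le, hx.2⟩
      have hcont : ContinuousAt (fun y : ℝ => RR γ t₀ y x - RR γ t₀ (-y) x) 0 := by
        obtain ⟨c0, hc0, hch⟩ := h.chord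
        have n1 : γ (t₀ + x) - γ t₀ ≠ 0 := by
          rw [← norm_pos_iff]
          have := abs_pos.2 hx0
          exact lt_of_lt_of_le (by positivity) (hch t₀ x hx')
        have n2 : (x:ℂ) ≠ 0 := by exact_mod_cast hx0
        unfold RR
        refine ContinuousAt.sub (ContinuousAt.sub (ContinuousAt.div ?_ ?_ ?_) (ContinuousAt.div ?_ ?_ ?_))
          (ContinuousAt.sub (ContinuousAt.div ?_ ?_ ?_) (ContinuousAt.div ?_ ?_ ?_))
        all_goals first | (apply Continuous.continuousAt; fun_prop) | (simpa using n1) | (simpa using n2)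
      have := hcont.tendsto
      simp only [neg_zero, sub_self] at this
      exact this.mono_left nhdsWithin_le_nhds
  have harc : Tendsto (fun y : ℝ => Real.arctan (1 / (2 * y))) (𝓝[>] 0) (𝓝 (Real.pi / 2)) := by
    have h1 : Tendsto (fun y : ℝ => 1 / (2 * y)) (𝓝[>] 0) atTop := by
      have := tendsto_inv_nhdsGT_zero (𝕜 := ℝ) |>.const_mul_atTop (show (0:ℝ) < 1/2 by norm_num)
      refine this.congr fun y => ?_
      rw [one_div, one_div, mul_inv]
    exact (Real.tendsto_arctan_atTop.mono_right nhdsWithin_le_nhds).comp h1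
  have harc' : Tendsto (fun y : ℝ => ((4 * Real.arctan (1 / (2 * y)) : ℝ) : ℂ) * I) (𝓝[>] 0)
      (𝓝 (((4 * (Real.pi / 2) : ℝ) : ℂ) * I)) :=
    ((Complex.continuous_ofReal.tendsto _).comp (harc.const_mul 4)).mul_const I
  have hsum := (hlim.add harc').const_mul w0
  have hone : w0 * ((∫ x in (-(1/2):ℝ)..(1/2), (0:ℂ)) + ((4 * (Real.pi / 2) : ℝ) : ℂ) * I) = 1 := by
    rw [intervalIntegral.integral_zero, zero_add, w0]
    push_cast
    have : (Real.pi : ℂ) ≠ 0 := by exact_mod_cast Real.pi_ne_zero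
    have := I_ne_zero
    field_simp
    norm_num
  rw [hone] at hsum
  refine hsum.congr' ?_
  filter_upwards [hsm] with y hy
  have cI : ∀ y : ℝ, y ≠ 0 → |y| ≤ η' → Continuous fun x => deriv γ (t₀ + x) / (γ (t₀ + x) - (γ t₀ + y * (I * g))) := by
    intro y hy0 hyη
    have hz := (hL t₀ t₀ y (by simp [hη'.le]) hyη hy0).notMem h hc
    have c3 : Continuous fun x : ℝ => t₀ + x := by fun_prop
    simpa [Function.comp_def] using (cont_integrand h (continuous_const (y := 1)) hz 1).comp c3
  have cL : ∀ y : ℝ, y ≠ 0 → Continuous fun x : ℝ => (1:ℂ) / (x - y * I) := by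
    intro y hy0
    have : ∀ x : ℝ, (x:ℂ) - y * I ≠ 0 := by
      intro x e
      have := congrArg Complex.im e
      simp at this; exact hy0 this
    fun_prop (disch := assumption)
  have eI : ∀ z, Ind γ z = w0 * ∫ x in (-(1/2):ℝ)..(1/2), deriv γ (t₀ + x) / (γ (t₀ + x) - z) := by
    intro z
    have p2 := per_shift (per_integrand h (f := fun _ => 1) (fun _ => rfl) z 1) t₀
    simp only [one_mul, pow_one] at p2
    rw [Ind, Cau]; simp only [one_mul]; rw [p2]
  have hy1 : y ≠ 0 := hy.1.ne'
  have hy2 : |y| ≤ η' := by rw [abs_of_pos hy.1]; exact hy.2.2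
  have d1 := (cI y hy1 hy2)
  have d2 := (cI (-y) (neg_ne_zero.2 hy1) (by rwa [abs_neg]))
  have d3 := (cL y hy1)
  have d4 := (cL (-y) (neg_ne_zero.2 hy1))
  rw [← line_int hy.1, ← intervalIntegral.integral_add, eI, eI, ← mul_sub, ← intervalIntegral.integral_sub]
  · congr 1; congr 1; ext x; unfold RR; ring
  · exact d1.intervalIntegrable _ _
  · exact d2.intervalIntegrable _ _
  · have := ((d1.sub d3).sub (d2.sub d4)).intervalIntegrable (μ := volume) (-(1/2)) (1/2)
    exact this
  · exact (d3.sub d4).intervalIntegrable _ _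

end CKA

namespace CKA

variable {γ : ℝ → ℂ} {a : ℝ}

structure Dom (Ω : Set ℂ) (γ : ℝ → ℂ) (a : ℝ) : Prop where
  cv : Curve γ a
  op : IsOpen Ω
  bd : Bornology.IsBounded Ω
  ne : Ω.Nonempty
  fr : frontier Ω = range γ

theorem Curve.strict (h : Curve γ a) (t₀ : ℝ) : HasStrictDerivAt γ (deriv γ t₀) t₀ :=
  (h.cd.contDiffAt (x := t₀)).hasStrictDerivAt one_ne_zero

/-- local coordinates -/
def Phi (γ : ℝ → ℂ) (t₀ : ℝ) (p : ℝ × ℝ) : ℂ := γ p.1 + p.2 * (I * deriv γ t₀)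

def PhiL (g : ℂ) : ℝ × ℝ →L[ℝ] ℂ :=
  (ContinuousLinearMap.toSpanSingleton ℝ g).comp (ContinuousLinearMap.fst ℝ ℝ ℝ) +
  (ContinuousLinearMap.toSpanSingleton ℝ (I * g)).comp (ContinuousLinearMap.snd ℝ ℝ ℝ)

theorem phiL_surj {g : ℂ} (hg : g ≠ 0) : Function.Surjective (PhiL g) := by
  intro w
  refine ⟨((w / g).re, (w / g).im), ?_⟩
  simp only [PhiL, add_apply, ContinuousLinearMap.comp_apply,
    ContinuousLinearMap.coe_fst', ContinuousLinearMap.coe_snd',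
    ContinuousLinearMap.toSpanSingleton_apply, Complex.real_smul]
  have := Complex.re_add_im (w / g)
  calc _ = ((w/g).re + (w/g).im * I) * g := by ring
    _ = w := by rw [this]; field_simp

theorem phi_strict (h : Curve γ a) (t₀ : ℝ) :
    HasStrictFDerivAt (Phi γ t₀) (PhiL (deriv γ t₀)) (t₀, 0) := by
  have h1 : HasStrictFDerivAt (fun p : ℝ × ℝ => γ p.1)
      ((ContinuousLinearMap.toSpanSingleton ℝ (deriv γ t₀)).comp (ContinuousLinearMap.fst ℝ ℝ ℝ)) (t₀, 0) :=
    HasStrictFDerivAt.comp (g := γ) (t₀, (0:ℝ)) (h.strict t₀).hasStrictFDerivAt hasStrictFDerivAt_fst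
  have h2 : HasStrictFDerivAt (fun p : ℝ × ℝ => (p.2:ℂ) * (I * deriv γ t₀))
      ((ContinuousLinearMap.toSpanSingleton ℝ (I * deriv γ t₀)).comp (ContinuousLinearMap.snd ℝ ℝ ℝ)) (t₀, 0) := by
    have := ((ContinuousLinearMap.toSpanSingleton ℝ (I * deriv γ t₀)).comp
      (ContinuousLinearMap.snd ℝ ℝ ℝ)).hasStrictFDerivAt (x := (t₀, (0:ℝ)))
    refine this.congr_of_eventuallyEq (Eventually.of_forall fun p => ?_)
    simp
  exact h1.add h2

theorem box_nhds (h : Curve γ a) (t₀ : ℝ) {ε : ℝ} (hε : 0 < ε) :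
    {w | ∃ t y : ℝ, |t - t₀| < ε ∧ |y| < ε ∧ w = γ t + y * (I * deriv γ t₀)} ∈ 𝓝 (γ t₀) := by
  have := (phi_strict h t₀).map_nhds_eq_of_surj (LinearMap.range_eq_top.2 (phiL_surj (h.ne t₀)))
  have e : Phi γ t₀ (t₀, 0) = γ t₀ := by simp [Phi]
  rw [e] at this
  rw [← this]
  have hb : ball ((t₀, 0) : ℝ × ℝ) ε ∈ 𝓝 ((t₀, 0) : ℝ × ℝ) := ball_mem_nhds _ hε
  refine mem_of_superset (image_mem_map hb) ?_
  rintro _ ⟨⟨t, y⟩, hp, rfl⟩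
  rw [mem_ball, Prod.dist_eq, max_lt_iff, Real.dist_eq, Real.dist_eq, sub_zero] at hp
  exact ⟨t, y, hp.1, hp.2, rfl⟩

/-- one side of the curve near `γ t₀` -/
def Sd (γ : ℝ → ℂ) (t₀ ε e : ℝ) : Set ℂ :=
  {w | ∃ t y : ℝ, |t - t₀| < ε ∧ 0 < y ∧ y < ε ∧ w = γ t + ((e * y : ℝ) : ℂ) * (I * deriv γ t₀)}

theorem sd_preconn (h : Curve γ a) (t₀ ε e : ℝ) : IsPreconnected (Sd γ t₀ ε e) := by
  have : Sd γ t₀ ε e = (fun p : ℝ × ℝ => γ p.1 + ((e * p.2 : ℝ) : ℂ) * (I * deriv γ t₀)) ''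
      (Ioo (t₀ - ε) (t₀ + ε) ×ˢ Ioo 0 ε) := by
    ext w
    constructor
    · rintro ⟨t, y, h1, h2, h3, rfl⟩
      refine ⟨(t, y), ⟨?_, h2, h3⟩, rfl⟩
      rw [abs_lt] at h1
      exact ⟨by linarith [h1.1], by linarith [h1.2]⟩
    · rintro ⟨⟨t, y⟩, ⟨h1, h2, h3⟩, rfl⟩
      exact ⟨t, y, abs_lt.2 ⟨by linarith [h1.1], by linarith [h1.2]⟩, h2, h3, rfl⟩
  rw [this]
  apply IsPreconnected.image
  · exact ((convex_Ioo _ _).prod (convex_Ioo _ _)).isPreconnected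
  · have := h.cont
    fun_prop

theorem sd_mono {t₀ ε ε' e : ℝ} (hh : ε ≤ ε') : Sd γ t₀ ε e ⊆ Sd γ t₀ ε' e := by
  rintro _ ⟨t, y, h1, h2, h3, rfl⟩
  exact ⟨t, y, h1.trans_le hh, h2, h3.trans_le hh, rfl⟩

theorem sd_closure {t₀ ε e t : ℝ} (ht : |t - t₀| < ε) : γ t ∈ closure (Sd γ t₀ ε e) := by
  have hε : 0 < ε := (abs_nonneg _).trans_lt ht
  have : Tendsto (fun y : ℝ => γ t + ((e * y : ℝ) : ℂ) * (I * deriv γ t₀)) (𝓝[>] 0)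
      (𝓝 (γ t + ((e * 0 : ℝ) : ℂ) * (I * deriv γ t₀))) := by
    refine Tendsto.mono_left (Continuous.tendsto ?_ _) nhdsWithin_le_nhds
    fun_prop
  simp only [mul_zero, ofReal_zero, zero_mul, add_zero] at this
  refine mem_closure_of_tendsto this ?_
  filter_upwards [Ioo_mem_nhdsGT hε] with y hy
  exact ⟨t, y, ht, hy.1, hy.2, rfl⟩

theorem ind_const (h : Curve γ a) {P : Set ℂ} (hP : IsPreconnected P) (hd : P ⊆ (range γ)ᶜ) {z w : ℂ}
    (hz : z ∈ P) (hw : w ∈ P) : Ind γ z = Ind γ w := by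
  have hop : IsOpen (range γ)ᶜ := h.compact.isClosed.isOpen_compl
  have hsub := hP.subset_connectedComponentIn hz hd
  have ho : IsOpen (connectedComponentIn (range γ)ᶜ z) := hop.connectedComponentIn
  refine ho.is_const_of_deriv_eq_zero (𝕜 := ℂ) isPreconnected_connectedComponentIn ?_ ?_ (hsub hz) (hsub hw)
  · intro x hx
    exact (ind_deriv h (connectedComponentIn_subset _ _ hx)).differentiableAt.differentiableWithinAt
  · intro x hx
    exact (ind_deriv h (connectedComponentIn_subset _ _ hx)).deriv

namespace Dom
variable {Ω : Set ℂ}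

theorem disj (D : Dom Ω γ a) : Disjoint Ω (range γ) := by
  rw [← D.fr, frontier, D.op.interior_eq]; exact disjoint_sdiff_right

theorem notMem (D : Dom Ω γ a) {z : ℂ} (hz : z ∈ Ω) : z ∉ range γ :=
  fun h => Set.disjoint_left.1 D.disj hz h

theorem clos (D : Dom Ω γ a) : closure Ω = Ω ∪ range γ := by
  rw [← D.fr, closure_eq_self_union_frontier]

theorem extNotMem (D : Dom Ω γ a) {z : ℂ} (hz : z ∈ (closure Ω)ᶜ) : z ∉ range γ :=
  fun h => hz (by rw [D.clos]; exact Or.inr h)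

theorem cases (D : Dom Ω γ a) (z : ℂ) : z ∈ Ω ∨ z ∈ range γ ∨ z ∈ (closure Ω)ᶜ := by
  by_cases h : z ∈ closure Ω
  · rw [D.clos] at h; exact h.imp_right Or.inl
  · exact Or.inr (Or.inr h)

theorem pre_cases (D : Dom Ω γ a) {P : Set ℂ} (hP : IsPreconnected P) (hd : P ⊆ (range γ)ᶜ) :
    P ⊆ Ω ∨ P ⊆ (closure Ω)ᶜ := by
  apply hP.subset_or_subset D.op isClosed_closure.isOpen_compl
  · exact Set.disjoint_left.2 fun z hz hz' => hz' (subset_closure hz)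
  · intro z hz
    rcases D.cases z with h | h | h
    · exact Or.inl h
    · exact absurd h (hd hz)
    · exact Or.inr h

theorem sd_miss (h : Curve γ a) : ∃ η : ℝ, 0 < η ∧ ∀ t₀ e : ℝ, (e = 1 ∨ e = -1) → Sd γ t₀ η e ⊆ (range γ)ᶜ := by
  obtain ⟨c, η, B, hc, hη, hB, hL⟩ := h.low_side
  refine ⟨η, hη, ?_⟩
  rintro t₀ e he _ ⟨t, y, h1, h2, h3, rfl⟩
  have ha : |e * y| = y := by rcases he with rfl | rfl <;> simp [abs_of_pos h2]
  exact (hL t₀ t (e * y) h1.le (ha.trans_le h3.le) (by rw [← abs_pos, ha]; exact h2)).notMem h hc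

theorem box_cases {t₀ ε : ℝ} {w : ℂ}
    (hw : ∃ t y : ℝ, |t - t₀| < ε ∧ |y| < ε ∧ w = γ t + y * (I * deriv γ t₀)) :
    w ∈ range γ ∨ ∀ e : ℝ, (e = 1 ∨ e = -1) → w ∈ Sd γ t₀ ε e ∨ w ∈ Sd γ t₀ ε (-e) := by
  obtain ⟨t, y, h1, h2, rfl⟩ := hw
  rw [abs_lt] at h2
  rcases lt_trichotomy y 0 with hy | hy | hy
  · right
    have : γ t + y * (I * deriv γ t₀) ∈ Sd γ t₀ ε (-1) := ⟨t, -y, h1, by linarith, by linarith, by simp⟩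
    rintro e (rfl | rfl)
    · exact Or.inr this
    · exact Or.inl this
  · left; subst hy; simp
  · right
    have : γ t + y * (I * deriv γ t₀) ∈ Sd γ t₀ ε 1 := ⟨t, y, h1, by linarith, by linarith, by simp⟩
    rintro e (rfl | rfl)
    · exact Or.inl this
    · rw [neg_neg]; exact Or.inr this

theorem sides0 (D : Dom Ω γ a) : ∃ η : ℝ, 0 < η ∧ ∀ t₀ : ℝ,
    (γ t₀ ∈ interior (closure Ω)) ∨
    ∃ e : ℝ, (e = 1 ∨ e = -1) ∧ Sd γ t₀ η e ⊆ Ω ∧ Sd γ t₀ η (-e) ⊆ (closure Ω)ᶜ := by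
  obtain ⟨η, hη, hm⟩ := sd_miss D.cv
  refine ⟨η, hη, fun t₀ => ?_⟩
  have p1 := D.pre_cases (sd_preconn D.cv t₀ η 1) (hm t₀ 1 (Or.inl rfl))
  have p2 := D.pre_cases (sd_preconn D.cv t₀ η (-1)) (hm t₀ (-1) (Or.inr rfl))
  rcases p1 with p1 | p1 <;> rcases p2 with p2 | p2
  · left
    rw [mem_interior_iff_mem_nhds]
    filter_upwards [box_nhds D.cv t₀ hη] with w hw
    rw [D.clos]
    rcases box_cases hw with h | h
    · exact Or.inr h
    · rcases h 1 (Or.inl rfl) with h | h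
      · exact Or.inl (p1 h)
      · exact Or.inl (p2 h)
  · exact Or.inr ⟨1, Or.inl rfl, p1, p2⟩
  · exact Or.inr ⟨-1, Or.inr rfl, p2, by rwa [neg_neg]⟩
  · exfalso
    have hc : γ t₀ ∈ closure Ω := by rw [D.clos]; exact Or.inr ⟨t₀, rfl⟩
    obtain ⟨w, hw, hwΩ⟩ := mem_closure_iff_nhds.1 hc _ (box_nhds D.cv t₀ hη)
    rcases box_cases hw with h | h
    · exact D.notMem hwΩ h
    · rcases h 1 (Or.inl rfl) with h | h
      · exact p1 h (subset_closure hwΩ)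
      · exact p2 h (subset_closure hwΩ)

theorem sides1 (D : Dom Ω γ a) : ∃ η : ℝ, 0 < η ∧ ∀ t₀ : ℝ,
    ∃ e : ℝ, (e = 1 ∨ e = -1) ∧ Sd γ t₀ η e ⊆ Ω ∧ Sd γ t₀ η (-e) ⊆ (closure Ω)ᶜ := by
  obtain ⟨η, hη, H⟩ := D.sides0
  refine ⟨η, hη, fun t₀ => (H t₀).resolve_left fun hb => ?_⟩
  have hopen : IsOpen {t | γ t ∈ interior (closure Ω)} := isOpen_interior.preimage D.cv.cont
  have hclosed : IsClosed {t | γ t ∈ interior (closure Ω)} := by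
    rw [← isOpen_compl_iff, isOpen_iff_mem_nhds]
    intro t ht
    obtain ⟨e, -, -, h2⟩ := (H t).resolve_left ht
    filter_upwards [ball_mem_nhds t hη] with s hs hs'
    have h3 : γ s ∈ closure (closure Ω)ᶜ :=
      closure_mono h2 (sd_closure (by rwa [mem_ball, Real.dist_eq] at hs))
    rw [closure_compl] at h3
    exact h3 hs'
  have huniv : {t | γ t ∈ interior (closure Ω)} = univ :=
    IsClopen.eq_univ ⟨hclosed, hopen⟩ ⟨t₀, hb⟩
  have hcl : IsClopen (closure Ω) := by
    refine ⟨isClosed_closure, ?_⟩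
    have : closure Ω ⊆ interior (closure Ω) := by
      nth_rewrite 1 [D.clos]
      rintro z (hz | ⟨t, rfl⟩)
      · exact interior_maximal subset_closure D.op hz
      · have : t ∈ {t | γ t ∈ interior (closure Ω)} := by rw [huniv]; trivial
        exact this
    rw [Subset.antisymm this interior_subset]; exact isOpen_interior
  have := hcl.eq_univ D.ne.closure
  have hb2 := D.bd.closure
  rw [this] at hb2
  exact NormedSpace.unbounded_univ ℂ ℂ hb2

theorem jmp (D : Dom Ω γ a) : ∃ η : ℝ, 0 < η ∧ ∀ t₀ : ℝ,
    ∃ e : ℝ, ((e = 1 ∨ e = -1) ∧ Sd γ t₀ η e ⊆ Ω ∧ Sd γ t₀ η (-e) ⊆ (closure Ω)ᶜ) ∧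
      ∃ A : ℂ, ∀ᶠ z in 𝓝 (γ t₀), (z ∈ Ω → Ind γ z = A + e) ∧ (z ∈ (closure Ω)ᶜ → Ind γ z = A) := by
  obtain ⟨η, hη, H⟩ := D.sides1
  refine ⟨η, hη, fun t₀ => ?_⟩
  obtain ⟨e, he, h1, h2⟩ := H t₀
  refine ⟨e, ⟨he, h1, h2⟩, ?_⟩
  have m1 : Sd γ t₀ η e ⊆ (range γ)ᶜ := fun z hz => D.notMem (h1 hz)
  have m2 : Sd γ t₀ η (-e) ⊆ (range γ)ᶜ := fun z hz => D.extNotMem (h2 hz)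
  have hp : ∀ e : ℝ, ∀ y : ℝ, 0 < y → y < η → γ t₀ + ((e * y : ℝ) : ℂ) * (I * deriv γ t₀) ∈ Sd γ t₀ η e :=
    fun e y hy hy' => ⟨t₀, y, by simpa using hη, hy, hy', rfl⟩
  have hy : (0:ℝ) < η / 2 := by positivity
  set z1 := γ t₀ + ((e * (η/2) : ℝ) : ℂ) * (I * deriv γ t₀)
  set z2 := γ t₀ + ((-e * (η/2) : ℝ) : ℂ) * (I * deriv γ t₀)
  have hz1 : z1 ∈ Sd γ t₀ η e := hp e (η/2) hy (by linarith)
  have hz2 : z2 ∈ Sd γ t₀ η (-e) := hp (-e) (η/2) hy (by linarith)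
  have hj : Ind γ z1 = Ind γ z2 + e := by
    have hlim : Tendsto (fun _ : ℝ => (e:ℂ) * (Ind γ z1 - Ind γ z2)) (𝓝[>] 0) (𝓝 1) := by
      refine (jump D.cv t₀).congr' ?_
      filter_upwards [Ioo_mem_nhdsGT hη] with y hy
      have q1 := ind_const D.cv (sd_preconn D.cv t₀ η e) m1 (hp e y hy.1 hy.2) hz1
      have q2 := ind_const D.cv (sd_preconn D.cv t₀ η (-e)) m2 (hp (-e) y hy.1 hy.2) hz2
      rcases he with rfl | rfl
      · simp only [one_mul, neg_mul] at q1 q2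
        rw [q1, q2]; simp
      · simp only [neg_neg, one_mul, neg_mul] at q1 q2
        rw [q1, q2]; simp
    have := tendsto_nhds_unique hlim tendsto_const_nhds
    rcases he with rfl | rfl
    · push_cast at this ⊢; linear_combination -this
    · push_cast at this ⊢; linear_combination this
  refine ⟨Ind γ z2, ?_⟩
  filter_upwards [box_nhds D.cv t₀ hη] with w hw
  rcases box_cases hw with h | h
  · exact ⟨fun h' => absurd h (D.notMem h'), fun h' => absurd h (D.extNotMem h')⟩
  · rcases h e he with h | h
    · refine ⟨fun _ => ?_, fun h' => absurd (subset_closure (h1 h)) h'⟩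
      rw [← hj]; exact ind_const D.cv (sd_preconn D.cv t₀ η e) m1 h hz1
    · refine ⟨fun h' => absurd (subset_closure h') (h2 h), fun _ => ?_⟩
      exact ind_const D.cv (sd_preconn D.cv t₀ η (-e)) m2 h hz2

theorem main (D : Dom Ω γ a) : ∃ η σ : ℝ, 0 < η ∧ (σ = 1 ∨ σ = -1) ∧ (∀ z ∈ Ω, Ind γ z = σ) ∧
    (∀ z ∈ (closure Ω)ᶜ, Ind γ z = 0) ∧
    ∀ t₀, Sd γ t₀ η σ ⊆ Ω ∧ Sd γ t₀ η (-σ) ⊆ (closure Ω)ᶜ := by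
  obtain ⟨η, hη, H⟩ := D.jmp
  choose e he A hA using H
  have hself : ∀ t₀, |t₀ - t₀| < η := fun t₀ => by simpa using hη
  have c1 : ∀ t, γ t ∈ closure Ω := fun t => closure_mono (he t).2.1 (sd_closure (hself t))
  have c2 : ∀ t, γ t ∈ closure (closure Ω)ᶜ := fun t => closure_mono (he t).2.2 (sd_closure (hself t))
  have hlc : IsLocallyConstant e := by
    rw [IsLocallyConstant.iff_eventually_eq]
    intro t
    have := D.cv.cont.continuousAt.eventually (eventually_eventually_nhds.2 (hA t))
    filter_upwards [this] with s hs
    obtain ⟨z, hz, hzΩ⟩ := mem_closure_iff_nhds.1 (c1 s) _ (hs.and (hA s))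
    obtain ⟨w, hw, hwΩ⟩ := mem_closure_iff_nhds.1 (c2 s) _ (hs.and (hA s))
    have e1 := hz.1.1 hzΩ
    have e2 := hz.2.1 hzΩ
    have e3 := hw.1.2 hwΩ
    have e4 := hw.2.2 hwΩ
    have : (e s : ℂ) = e t := by linear_combination e1 - e2 - e3 + e4
    exact_mod_cast this
  have hconst : ∀ t, e t = e 0 := fun t => hlc.apply_eq_of_preconnectedSpace t 0
  have hloc : ∀ z, ∃ A : ℂ, ∀ᶠ w in 𝓝 z, (w ∈ Ω → Ind γ w = A + e 0) ∧ (w ∈ (closure Ω)ᶜ → Ind γ w = A) := by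
    intro z
    have hloc' : z ∉ range γ → ∀ᶠ w in 𝓝 z, Ind γ w = Ind γ z := by
      intro hz
      obtain ⟨r, hr, hr'⟩ := Metric.isOpen_iff.1 D.cv.compact.isClosed.isOpen_compl z hz
      filter_upwards [ball_mem_nhds z hr] with w hw
      exact ind_const D.cv (convex_ball z r).isPreconnected hr' hw (mem_ball_self hr)
    rcases D.cases z with h | ⟨t, rfl⟩ | h
    · refine ⟨Ind γ z - e 0, ?_⟩
      filter_upwards [hloc' (D.notMem h), D.op.mem_nhds h] with w hw hw'
      exact ⟨fun _ => by rw [hw]; ring, fun h' => absurd (subset_closure hw') h'⟩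
    · refine ⟨A t, ?_⟩
      rw [← hconst t]; exact hA t
    · refine ⟨Ind γ z, ?_⟩
      filter_upwards [hloc' (D.extNotMem h), isClosed_closure.isOpen_compl.mem_nhds h] with w hw hw'
      exact ⟨fun h' => absurd (subset_closure h') hw', fun _ => hw⟩
  choose W hW using hloc
  have hWc : IsLocallyConstant W := by
    rw [IsLocallyConstant.iff_eventually_eq]
    intro z
    filter_upwards [eventually_eventually_nhds.2 (hW z)] with s hs
    have := hs.and (hW s)
    have hcl : s ∈ closure Ω ∨ s ∈ closure (closure Ω)ᶜ := by
      by_cases h : s ∈ closure Ω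
      · exact Or.inl h
      · exact Or.inr (subset_closure h)
    rcases hcl with h | h
    · obtain ⟨z, hz, hzΩ⟩ := mem_closure_iff_nhds.1 h _ this
      have e1 := hz.1.1 hzΩ
      have e2 := hz.2.1 hzΩ
      linear_combination e1 - e2
    · obtain ⟨z, hz, hzΩ⟩ := mem_closure_iff_nhds.1 h _ this
      have e1 := hz.1.2 hzΩ
      have e2 := hz.2.2 hzΩ
      linear_combination e1 - e2
  have hW0 : ∀ z, W z = 0 := by
    have hc : ∀ z, W z = W 0 := fun z => hWc.apply_eq_of_preconnectedSpace z 0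
    have h0 : W 0 = 0 := by
      have hinf : Tendsto (Ind γ) (cocompact ℂ) (𝓝 0) := cau_infty D.cv continuous_const (fun _ => rfl)
      have : Tendsto (Ind γ) (cocompact ℂ) (𝓝 (W 0)) := by
        refine tendsto_const_nhds.congr' ?_
        have : (closure Ω)ᶜ ∈ cocompact ℂ := D.bd.isCompact_closure.compl_mem_cocompact
        filter_upwards [this] with z hz
        rw [(hW z).self_of_nhds.2 hz, hc z]
      exact tendsto_nhds_unique this hinf
    exact fun z => (hc z).trans h0
  refine ⟨η, e 0, hη, (he 0).1, fun z hz => ?_, fun z hz => ?_, fun t => ?_⟩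
  · rw [(hW z).self_of_nhds.1 hz, hW0, zero_add]
  · rw [(hW z).self_of_nhds.2 hz, hW0]
  · rw [← hconst t]; exact (he t).2

end Dom
end CKA

namespace CKA

variable {γ : ℝ → ℂ} {a : ℝ}

theorem near_rep (s t : ℝ) : ∃ n : ℤ, |t + n - s| ≤ 1/2 := by
  refine ⟨-round (t - s), ?_⟩
  have := abs_sub_round (t - s)
  push_cast
  rwa [show t + -(round (t - s) : ℝ) - s = t - s - round (t - s) by ring]

theorem per_add_int {g : ℝ → ℂ} (hg : Function.Periodic g 1) (t : ℝ) (n : ℤ) : g (t + n) = g t := by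
  have := (hg.int_mul n) t
  rwa [mul_one] at this

theorem Curve.per_int (h : Curve γ a) {s t : ℝ} (e : γ s = γ t) : ∃ n : ℤ, t + n = s := by
  obtain ⟨n, hn⟩ := near_rep s t
  refine ⟨n, ?_⟩
  refine (h.inj s (t + n) (by linarith) ?_).symm
  rw [per_add_int h.per, e]

theorem Curve.eq_of (h : Curve γ a) {g : ℝ → ℂ} (hg : Function.Periodic g 1) {s t : ℝ} (e : γ s = γ t) :
    g s = g t := by
  obtain ⟨n, rfl⟩ := h.per_int e
  exact per_add_int hg t n

theorem Curve.hol_chord (h : Curve γ a) {g : ℝ → ℂ} (hp : Function.Periodic g 1) (hg : Hol a g) :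
    ∃ K : ℝ, 0 ≤ K ∧ ∀ s t, ‖g s - g t‖ ≤ K * ‖γ s - γ t‖ ^ a := by
  obtain ⟨C, hC, hC'⟩ := hg
  obtain ⟨c, hc, hch⟩ := h.chord
  refine ⟨C / c ^ a, by positivity, fun s t => ?_⟩
  obtain ⟨n, hn⟩ := near_rep t s
  rw [← per_add_int hp s n, ← per_add_int h.per s n]
  set r := s + n
  refine (hC' r t).trans ?_
  have h1 := hch t (r - t) hn
  rw [add_sub_cancel] at h1
  have h2 : |r - t| ^ a ≤ (‖γ r - γ t‖ / c) ^ a := by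
    apply Real.rpow_le_rpow (abs_nonneg _) _ h.ha.le
    rw [le_div_iff₀ hc]; linarith
  rw [Real.div_rpow (norm_nonneg _) hc.le] at h2
  calc C * |r - t| ^ a ≤ C * (‖γ r - γ t‖ ^ a / c ^ a) := by gcongr
    _ = _ := by ring

theorem hol_of_local (ha : 0 < a) {g : ℝ → ℂ} (hp : Function.Periodic g 1) {C η : ℝ} (hC : 0 ≤ C) (hη : 0 < η)
    (H : ∀ s t, |s - t| < η → ‖g s - g t‖ ≤ C * |s - t| ^ a) : Hol a g := by
  have hcont : Continuous g := by
    rw [continuous_iff_continuousAt]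
    intro t
    rw [ContinuousAt, tendsto_iff_norm_sub_tendsto_zero]
    have h1 : Tendsto (fun s : ℝ => C * |s - t| ^ a) (𝓝 t) (𝓝 (C * |t - t| ^ a)) := by
      apply Continuous.tendsto
      have : Continuous fun s : ℝ => |s - t| := by fun_prop
      exact continuous_const.mul (this.rpow_const fun _ => Or.inr ha.le)
    rw [sub_self, abs_zero, Real.zero_rpow ha.ne', mul_zero] at h1
    refine squeeze_zero' (Eventually.of_forall fun _ => norm_nonneg _) ?_ h1
    filter_upwards [ball_mem_nhds t hη] with s hs
    exact H s t hs
  obtain ⟨M, hM, hM'⟩ := per_bdd hp hcont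
  refine ⟨max C (2 * M / η ^ a), by positivity, fun s t => ?_⟩
  rcases lt_or_ge |s - t| η with h | h
  · exact (H s t h).trans (by gcongr; exact le_max_left _ _)
  · have h1 := Real.rpow_le_rpow hη.le h ha.le
    calc ‖g s - g t‖ ≤ ‖g s‖ + ‖g t‖ := norm_sub_le _ _
      _ ≤ 2 * M := by linarith [hM' s, hM' t]
      _ = 2 * M / η ^ a * η ^ a := by field_simp
      _ ≤ _ := by gcongr; exact le_max_right _ _

structure Side (O : Set ℂ) (γ : ℝ → ℂ) (a : ℝ) (τ : ℂ) (η e : ℝ) : Prop where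
  cv : Curve γ a
  op : IsOpen O
  miss : ∀ z ∈ O, z ∉ range γ
  ind : ∀ z ∈ O, Ind γ z = τ
  he : e = 1 ∨ e = -1
  hη : 0 < η
  sd : ∀ t₀, Sd γ t₀ η e ⊆ O
  sd' : ∀ t₀, ∀ z ∈ Sd γ t₀ η (-e), z ∉ O
  cl : ∀ P : Set ℂ, IsPreconnected P → P ⊆ (range γ)ᶜ → (P ∩ O).Nonempty → P ⊆ O

/-- boundary values -/
def BV (γ f : ℝ → ℂ) (τ : ℂ) (s : ℝ) : ℂ := f s * τ + VV γ f (γ s) s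

/-- the extended Cauchy integral -/
def EE (O : Set ℂ) (γ f : ℝ → ℂ) (τ : ℂ) (z : ℂ) : ℂ :=
  open Classical in if z ∈ O then Cau γ f z else BV γ f τ (Function.invFun γ z)

theorem bv_per (h : Curve γ a) {f : ℝ → ℂ} (hf : Function.Periodic f 1) (τ : ℂ) :
    Function.Periodic (BV γ f τ) 1 := by
  intro s
  unfold BV VV
  simp only [hf s, h.per s, add_right_comm s 1, hf _, h.per _, h.perd _]

namespace Side
variable {O : Set ℂ} {τ : ℂ} {η e : ℝ}

theorem ee_O {f : ℝ → ℂ} {z : ℂ} (hz : z ∈ O) : EE O γ f τ z = Cau γ f z := by simp [EE, hz]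

theorem ee_J (D : Side O γ a τ η e) {f : ℝ → ℂ} (hf : Function.Periodic f 1) (s : ℝ) :
    EE O γ f τ (γ s) = BV γ f τ s := by
  have : γ s ∉ O := fun h => D.miss _ h ⟨s, rfl⟩
  simp only [EE, this, if_false]
  exact D.cv.eq_of (bv_per D.cv hf τ) (Function.invFun_eq ⟨s, rfl⟩)

theorem est1 (D : Side O γ a τ η e) {f : ℝ → ℂ} (hf : CH a 0 f) {c B : ℝ} (hc : 0 < c) (hB : 0 < B) :
    ∃ K : ℝ, 0 ≤ K ∧ ∀ z s d, z ∈ O → Low γ c B z s d → ‖Cau γ f z - BV γ f τ s‖ ≤ K * d ^ a := by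
  obtain ⟨K, hK, H⟩ := est_b D.cv hf hc hB
  refine ⟨K, hK, fun z s d hz hl => ?_⟩
  rw [cau_eq D.cv hf.per (hf.cont D.cv.ha) (D.miss z hz) s, D.ind z hz, BV, add_sub_add_left_eq_sub]
  exact H z s d hl

theorem abs_e {e y : ℝ} (he : e = 1 ∨ e = -1) (hy : 0 < y) : |e * y| = y := by
  rcases he with rfl | rfl <;> simp [abs_of_pos hy]

theorem bv_hol (D : Side O γ a τ η e) {f : ℝ → ℂ} (hf : CH a 0 f) : Hol a (BV γ f τ) := by
  have h := D.cv
  obtain ⟨c, η', B, hc, hη', hB, hL⟩ := h.low_side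
  obtain ⟨K, hK, H1⟩ := D.est1 hf hc hB
  obtain ⟨K2, hK2, H2⟩ := est_g h (B := B) hf hc
  obtain ⟨M, hM, hM'⟩ := per_bdd h.perd h.contd
  refine hol_of_local h.ha (bv_per h hf.per τ) (C := 2 * K + K2 * M) (by positivity) (lt_min D.hη hη') ?_
  intro s t hst
  rcases eq_or_ne s t with rfl | hne
  · simp [Real.zero_rpow h.ha.ne']
  set y := |s - t| with hy
  have hy0 : 0 < y := abs_pos.2 (sub_ne_zero.2 hne)
  have hyη : y < η := hst.trans_le (min_le_left _ _)
  have hyη' : y < η' := hst.trans_le (min_le_right _ _)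
  set P : ℝ → ℂ := fun r => γ r + ((e * y : ℝ) : ℂ) * (I * deriv γ s) with hP
  have ae := abs_e D.he hy0
  have hPO : ∀ r, |r - s| ≤ y → P r ∈ O := fun r hr => D.sd s ⟨r, y, hr.trans_lt hyη, hy0, hyη, rfl⟩
  have hPL : ∀ r, |r - s| ≤ y → Low γ c B (P r) r y := by
    intro r hr
    have := hL s r (e * y) (hr.trans hyη'.le) (ae.trans_le hyη'.le) (by rw [← abs_pos, ae]; exact hy0)
    rwa [ae] at this
  have hs : |s - s| ≤ y := by simpa using hy0.le
  have ht : |t - s| ≤ y := by rw [abs_sub_comm]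
  have b1 := H1 _ _ _ (hPO s hs) (hPL s hs)
  have b2 := H1 _ _ _ (hPO t ht) (hPL t ht)
  have hseg : ∀ r ∈ uIcc s t, |r - s| ≤ y := by
    intro r hr
    rw [abs_sub_comm s t] at hy
    rw [hy]; exact abs_sub_left_of_mem_uIcc hr
  have b3 : ‖Cau γ f (P t) - Cau γ f (P s)‖ ≤ (K2 * y ^ (a - 1) * M) * ‖t - s‖ := by
    refine Convex.norm_image_sub_le_of_norm_hasDerivWithin_le (𝕜 := ℝ) (f := fun r => Cau γ f (P r))
      (f' := fun r => Cau2 γ f (P r) * deriv γ r)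
      (s := uIcc s t) ?_ ?_ (convex_uIcc s t) left_mem_uIcc right_mem_uIcc
    · intro r hr
      have d1 : HasDerivAt P (deriv γ r) r := (h.hd r).add_const _
      have d2 := cau_deriv h (hf.cont h.ha) (D.miss _ (hPO r (hseg r hr)))
      have := HasDerivAt.scomp (𝕜' := ℂ) r d2 d1
      simp only [smul_eq_mul] at this
      rw [mul_comm] at this
      exact this.hasDerivWithinAt
    · intro r hr
      rw [norm_mul]
      have := H2 _ _ _ (hPL r (hseg r hr))
      have := hM' r
      gcongr
  have e1 : y ^ (a - 1) * ‖t - s‖ = y ^ a := by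
    have := rpow_split (x := s - t) h.ha
    rw [Real.norm_eq_abs, abs_sub_comm t s]; exact this.symm
  have e2 : (K2 * y ^ (a - 1) * M) * ‖t - s‖ = K2 * M * y ^ a := by rw [← e1]; ring
  rw [e2] at b3
  have : BV γ f τ s - BV γ f τ t = -(Cau γ f (P s) - BV γ f τ s) + (Cau γ f (P t) - BV γ f τ t)
      - (Cau γ f (P t) - Cau γ f (P s)) := by ring
  rw [this]
  refine (norm_sub_le _ _).trans ((add_le_add_left (norm_add_le _ _) _).trans ?_)
  rw [norm_neg]
  linarith

theorem ee_hol (D : Side O γ a τ η e) {f : ℝ → ℂ} (hf : CH a 0 f) :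
    ∃ K : ℝ, 0 ≤ K ∧ ∀ z ∈ O ∪ range γ, ∀ w ∈ O ∪ range γ,
      ‖EE O γ f τ z - EE O γ f τ w‖ ≤ K * ‖z - w‖ ^ a := by
  have h := D.cv
  obtain ⟨c, hc, hL⟩ := h.low_near
  obtain ⟨K, hK, H1⟩ := D.est1 hf hc one_pos
  obtain ⟨K2, hK2, H2⟩ := est_g h (B := 1) hf hc
  obtain ⟨K3, hK3, H3⟩ := h.hol_chord (bv_per h hf.per τ) (D.bv_hol hf)
  have hne := range_nonempty γ
  have hpos : ∀ z, z ∉ range γ → 0 < infDist z (range γ) := fun z hz =>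
    (h.compact.isClosed.notMem_iff_infDist_pos hne).1 hz
  have hnear : ∀ z ∈ O ∪ range γ, ∃ s, infDist z (range γ) = ‖z - γ s‖ ∧
      ‖EE O γ f τ z - BV γ f τ s‖ ≤ K * (infDist z (range γ)) ^ a := by
    intro z hz
    obtain ⟨s, -, hs⟩ := h.near z
    refine ⟨s, hs, ?_⟩
    rcases hz with hz | hz
    · rw [ee_O hz]
      exact H1 _ _ _ hz (hL z s (D.miss z hz) hs)
    · have h0 : infDist z (range γ) = 0 := infDist_zero_of_mem hz
      have : z = γ s := by rw [h0] at hs; exact sub_eq_zero.1 (norm_eq_zero.1 hs.symm)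
      rw [this, D.ee_J hf.per, sub_self, norm_zero]
      have := infDist_nonneg (x := γ s) (s := range γ)
      positivity
  refine ⟨K2 + K * 2 ^ a + K * 3 ^ a + K3 * 6 ^ a, by positivity, fun z hz w hw => ?_⟩
  rcases eq_or_ne z w with rfl | hzw
  · simp [Real.zero_rpow h.ha.ne']
  have hρ : 0 < ‖z - w‖ := norm_pos_iff.2 (sub_ne_zero.2 hzw)
  set ρ := ‖z - w‖ with hρ'
  have hρa : 0 ≤ ρ ^ a := by positivity
  set d := infDist z (range γ) with hd
  rcases lt_or_ge ρ (d / 2) with hlt | hge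
  · have hd0 : 0 < d := by linarith
    have hbm : ball z d ⊆ (range γ)ᶜ := by
      intro p hp hp'
      have := infDist_le_dist_of_mem (x := z) hp'
      rw [mem_ball, dist_comm] at hp
      linarith
    have hzO : z ∈ O := hz.resolve_right (hbm (mem_ball_self hd0))
    have hbO : ball z d ⊆ O := D.cl _ (convex_ball z d).isPreconnected hbm ⟨z, mem_ball_self hd0, hzO⟩
    have hsub : closedBall z ρ ⊆ ball z d := closedBall_subset_ball (by linarith)
    have hzc : z ∈ closedBall z ρ := mem_closedBall_self hρ.le
    have hwc : w ∈ closedBall z ρ := by rw [mem_closedBall, dist_comm, dist_eq_norm]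
    have hwO : w ∈ O := hbO (hsub hwc)
    rw [ee_O hzO, ee_O hwO]
    have : ‖Cau γ f z - Cau γ f w‖ ≤ (K2 * ρ ^ (a - 1)) * ‖z - w‖ := by
      refine Convex.norm_image_sub_le_of_norm_hasDerivWithin_le (𝕜 := ℂ) (f := Cau γ f)
        (f' := Cau2 γ f) (s := closedBall z ρ) ?_ ?_ (convex_closedBall z ρ) hwc hzc
      · intro p hp
        exact (cau_deriv h (hf.cont h.ha) (hbm (hsub hp))).hasDerivWithinAt
      · intro p hp
        obtain ⟨s, -, hs⟩ := h.near p
        refine (H2 _ _ _ (hL p s (hbm (hsub hp)) hs)).trans ?_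
        have h1 : ρ ≤ infDist p (range γ) := by
          have := infDist_le_infDist_add_dist (s := range γ) (x := z) (y := p)
          rw [mem_closedBall, dist_comm] at hp
          linarith
        have := Real.rpow_le_rpow_of_nonpos hρ h1 (show a - 1 ≤ 0 by linarith [h.ha1])
        gcongr
    refine this.trans ?_
    have e1 : ρ ^ (a - 1) * ρ = ρ ^ a := by
      rw [← Real.rpow_add_one hρ.ne', sub_add_cancel]
    rw [mul_assoc, e1]
    have : 0 ≤ K * (2:ℝ) ^ a + K * 3 ^ a + K3 * 6 ^ a := by positivity
    nlinarith
  · obtain ⟨s, hs, hs'⟩ := hnear z hz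
    obtain ⟨t, ht, ht'⟩ := hnear w hw
    have h1 : d ≤ 2 * ρ := by linarith
    have h2 : infDist w (range γ) ≤ 3 * ρ := by
      have := infDist_le_infDist_add_dist (s := range γ) (x := w) (y := z)
      rw [dist_comm, dist_eq_norm] at this
      linarith
    have h3 : ‖γ s - γ t‖ ≤ 6 * ρ := by
      have : γ s - γ t = -(z - γ s) + (w - γ t) + (z - w) := by ring
      rw [this]
      refine (norm_add_le _ _).trans ((add_le_add_left (norm_add_le _ _) _).trans ?_)
      rw [norm_neg]; linarith
    have ha := h.ha.le
    have p1 : d ^ a ≤ 2 ^ a * ρ ^ a := by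
      rw [← Real.mul_rpow (by norm_num) hρ.le]; exact Real.rpow_le_rpow infDist_nonneg h1 ha
    have p2 : (infDist w (range γ)) ^ a ≤ 3 ^ a * ρ ^ a := by
      rw [← Real.mul_rpow (by norm_num) hρ.le]; exact Real.rpow_le_rpow infDist_nonneg h2 ha
    have p3 : ‖γ s - γ t‖ ^ a ≤ 6 ^ a * ρ ^ a := by
      rw [← Real.mul_rpow (by norm_num) hρ.le]; exact Real.rpow_le_rpow (norm_nonneg _) h3 ha
    have q1 := mul_le_mul_of_nonneg_left p1 hK
    have q2 := mul_le_mul_of_nonneg_left p2 hK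
    have q3 := mul_le_mul_of_nonneg_left p3 hK3
    have q4 := H3 s t
    have : EE O γ f τ z - EE O γ f τ w = (EE O γ f τ z - BV γ f τ s) - (EE O γ f τ w - BV γ f τ t)
      + (BV γ f τ s - BV γ f τ t) := by ring
    rw [this]
    refine (norm_add_le _ _).trans ((add_le_add_left (norm_sub_le _ _) _).trans ?_)
    have : 0 ≤ K2 * ρ ^ a := by positivity
    nlinarith

theorem ee_cont (D : Side O γ a τ η e) {f : ℝ → ℂ} (hf : CH a 0 f) :
    ContinuousOn (EE O γ f τ) (O ∪ range γ) := by
  obtain ⟨K, hK, H⟩ := D.ee_hol hf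
  intro z hz
  rw [ContinuousWithinAt, tendsto_iff_norm_sub_tendsto_zero]
  have h1 : Tendsto (fun w : ℂ => K * ‖w - z‖ ^ a) (𝓝 z) (𝓝 (K * ‖z - z‖ ^ a)) := by
    apply Continuous.tendsto
    have : Continuous fun s : ℂ => ‖s - z‖ := by fun_prop
    exact continuous_const.mul (this.rpow_const fun _ => Or.inr D.cv.ha.le)
  rw [sub_self, norm_zero, Real.zero_rpow D.cv.ha.ne', mul_zero] at h1
  refine squeeze_zero' (Eventually.of_forall fun _ => norm_nonneg _) ?_ (h1.mono_left nhdsWithin_le_nhds)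
  filter_upwards [self_mem_nhdsWithin] with w hw
  exact H w hw z hz

end Side
end CKA

namespace CKA

variable {γ : ℝ → ℂ} {a : ℝ}

/-- derivative along the curve -/
def dd (γ f : ℝ → ℂ) : ℝ → ℂ := fun t => deriv f t * (deriv γ t)⁻¹

theorem dd_ch (h : Curve γ a) {f : ℝ → ℂ} {m : ℕ} (hγ : CH a m (deriv γ)) (hf : CH a (m+1) f) :
    CH a m (dd γ f) := CH.mul h.ha h.ha1 hf.2.2 (CH.inv h.ha h.ha1 hγ h.ne)

theorem dd_ch0 (h : Curve γ a) {f : ℝ → ℂ} (hf : CH a 1 f) : CH a 0 (dd γ f) :=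
  dd_ch h ⟨h.perd, h.hol⟩ hf

namespace Side
variable {O : Set ℂ} {τ : ℂ} {η e : ℝ}

theorem bd_est0 (D : Side O γ a τ η e) {f : ℝ → ℂ} (hf : CH a 1 f) (s : ℝ) :
    ∃ C : ℝ, 0 ≤ C ∧ ∀ t y : ℝ, |t - s| < η → 0 < y → y < η →
      ‖EE O γ f τ (γ t + ((e * y : ℝ) : ℂ) * (I * deriv γ s)) - EE O γ f τ (γ s) - EE O γ (dd γ f) τ (γ s) *
        (γ t + ((e * y : ℝ) : ℂ) * (I * deriv γ s) - γ s)‖ ≤ C * (|t - s| + y) ^ a * (|t - s| + y) := by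
  have h := D.cv
  obtain ⟨K, hK, H⟩ := D.ee_hol (dd_ch0 h hf)
  obtain ⟨M, hM, hM'⟩ := per_bdd h.perd h.contd
  refine ⟨K * M ^ a * M, by positivity, fun t y ht hy hyη => ?_⟩
  set g := deriv γ s with hg
  set ρ := |t - s| + y with hρ
  have hρ0 : 0 ≤ ρ := by positivity
  have ae := abs_e D.he hy
  set L := EE O γ (dd γ f) τ (γ s)
  set P : ℝ → ℂ := fun r => γ (s + r * (t - s)) + ((e * (r * y) : ℝ) : ℂ) * (I * g) with hP
  have hPO : ∀ r, 0 < r → r ≤ 1 → P r ∈ O := by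
    intro r hr hr1
    refine D.sd s ⟨s + r * (t - s), r * y, ?_, by positivity, ?_, rfl⟩
    · rw [add_sub_cancel_left, abs_mul, abs_of_pos hr]
      nlinarith [abs_nonneg (t - s)]
    · nlinarith
  have hP0 : P 0 = γ s := by simp [hP]
  have hP1 : P 1 = γ t + ((e * y : ℝ) : ℂ) * (I * g) := by simp [hP]
  set P' : ℝ → ℂ := fun r => ((t - s : ℝ):ℂ) * deriv γ (s + r * (t - s)) + ((e * y : ℝ) : ℂ) * (I * g) with hP'
  have hPd : ∀ r, HasDerivAt P (P' r) r := by
    intro r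
    have i1 : HasDerivAt (fun r : ℝ => s + r * (t - s)) (t - s) r := by
      simpa using ((hasDerivAt_id r).mul_const (t - s)).const_add s
    have d1 : HasDerivAt (fun r : ℝ => γ (s + r * (t - s))) (((t - s : ℝ):ℂ) * deriv γ (s + r * (t - s))) r := by
      have := HasDerivAt.scomp (𝕜' := ℝ) r (h.hd (s + r * (t - s))) i1
      rw [Complex.real_smul] at this
      exact this
    have i2 : HasDerivAt (fun r : ℝ => e * (r * y)) (e * y) r := by
      simpa using ((hasDerivAt_id r).mul_const y).const_mul e
    exact d1.add (i2.ofReal_comp.mul_const _)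
  have hP'b : ∀ r, ‖P' r‖ ≤ M * ρ := by
    intro r
    refine (norm_add_le _ _).trans ?_
    rw [norm_mul, norm_mul, norm_mul, Complex.norm_real, Complex.norm_real, norm_I, one_mul, Real.norm_eq_abs,
      Real.norm_eq_abs, ae]
    have := hM' (s + r * (t - s))
    have := hM' s
    calc _ ≤ |t - s| * M + y * M := by gcongr
      _ = _ := by rw [hρ]; ring
  have hPc : Continuous P := continuous_iff_continuousAt.2 fun r => (hPd r).continuousAt
  have hPn : ∀ r, 0 < r → r ≤ 1 → ‖P r - γ s‖ ≤ M * ρ := by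
    intro r hr hr1
    have := Convex.norm_image_sub_le_of_norm_hasDerivWithin_le (𝕜 := ℝ) (f := P) (f' := P') (s := univ)
      (C := M * ρ) (x := 0) (y := r) (fun x _ => (hPd x).hasDerivWithinAt) (fun x _ => hP'b x)
      convex_univ trivial trivial
    rw [hP0, sub_zero, Real.norm_eq_abs, abs_of_pos hr] at this
    refine this.trans ?_
    have : 0 ≤ M * ρ := by positivity
    nlinarith
  set G : ℝ → ℂ := fun r => EE O γ f τ (P r) - L * P r with hG
  have hGd : ∀ r ∈ Ioc (0:ℝ) 1, HasDerivAt G ((EE O γ (dd γ f) τ (P r) - L) * P' r) r := by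
    intro r hr
    have hO := hPO r hr.1 hr.2
    have d1 : HasDerivAt (EE O γ f τ) (EE O γ (dd γ f) τ (P r)) (P r) := by
      rw [ee_O hO]
      refine (cau_hasDeriv h hf (D.miss _ hO)).congr_of_eventuallyEq ?_
      filter_upwards [D.op.mem_nhds hO] with w hw
      exact ee_O hw
    have d2 := HasDerivAt.scomp (𝕜' := ℂ) r d1 (hPd r)
    have d3 := d2.sub ((hPd r).const_mul L)
    refine d3.congr_deriv ?_
    rw [smul_eq_mul]; ring
  have hGb : ∀ r ∈ Ioc (0:ℝ) 1, ‖(EE O γ (dd γ f) τ (P r) - L) * P' r‖ ≤ K * (M * ρ) ^ a * (M * ρ) := by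
    intro r hr
    rw [norm_mul]
    have b1 := H (P r) (Or.inl (hPO r hr.1 hr.2)) (γ s) (Or.inr ⟨s, rfl⟩)
    have b2 := Real.rpow_le_rpow (norm_nonneg _) (hPn r hr.1 hr.2) h.ha.le
    have b3 : ‖EE O γ (dd γ f) τ (P r) - L‖ ≤ K * (M * ρ) ^ a := b1.trans (by gcongr)
    have b4 := hP'b r
    gcongr
  have hfin : ∀ r ∈ Ioc (0:ℝ) 1, ‖G 1 - G r‖ ≤ K * (M * ρ) ^ a * (M * ρ) := by
    intro r hr
    have := Convex.norm_image_sub_le_of_norm_hasDerivWithin_le (𝕜 := ℝ) (f := G)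
      (fun x hx => (hGd x hx).hasDerivWithinAt) hGb (convex_Ioc 0 1) hr ⟨one_pos, le_rfl⟩
    refine this.trans ?_
    rw [Real.norm_eq_abs, abs_of_nonneg (by linarith [hr.2])]
    have h0 : 0 ≤ K * (M * ρ) ^ a * (M * ρ) := by positivity
    nlinarith [hr.1]
  have hf0 : CH a 0 f := CH.zero h.ha h.ha1 hf
  have hlim : Tendsto (fun r => ‖G 1 - G r‖) (𝓝[>] 0) (𝓝 ‖G 1 - G 0‖) := by
    refine (Tendsto.sub tendsto_const_nhds ?_).norm
    refine Tendsto.sub ?_ ?_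
    · have := D.ee_cont hf0 (P 0) (by rw [hP0]; exact Or.inr ⟨s, rfl⟩)
      refine Tendsto.comp this ?_
      rw [tendsto_nhdsWithin_iff]
      refine ⟨(hPc.tendsto 0).mono_left nhdsWithin_le_nhds, ?_⟩
      filter_upwards [Ioc_mem_nhdsGT (zero_lt_one' ℝ)] with r hr
      exact Or.inl (hPO r hr.1 hr.2)
    · exact ((hPc.const_mul L).tendsto 0).mono_left nhdsWithin_le_nhds
  have hle : ‖G 1 - G 0‖ ≤ K * (M * ρ) ^ a * (M * ρ) := by
    refine le_of_tendsto hlim ?_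
    filter_upwards [Ioc_mem_nhdsGT (zero_lt_one' ℝ)] with r hr
    exact hfin r hr
  rw [Real.mul_rpow hM.le hρ0] at hle
  calc _ = ‖G 1 - G 0‖ := by
        rw [hG]; simp only [hP1, hP0]; congr 1; ring
    _ ≤ _ := hle
    _ = _ := by ring

theorem bd_est1 (D : Side O γ a τ η e) {f : ℝ → ℂ} (hf : CH a 1 f) (s : ℝ) :
    ∃ C : ℝ, 0 ≤ C ∧ ∀ t : ℝ, |t - s| < η →
      ‖EE O γ f τ (γ t) - EE O γ f τ (γ s) - EE O γ (dd γ f) τ (γ s) *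
        (γ t - γ s)‖ ≤ C * |t - s| ^ a * |t - s| := by
  obtain ⟨C, hC, H⟩ := D.bd_est0 hf s
  refine ⟨C, hC, fun t ht => ?_⟩
  have hf0 : CH a 0 f := CH.zero D.cv.ha D.cv.ha1 hf
  have l0 : Tendsto (fun y : ℝ => γ t + ((e * y : ℝ) : ℂ) * (I * deriv γ s)) (𝓝[>] 0) (𝓝 (γ t)) := by
    have : Continuous (fun y : ℝ => γ t + ((e * y : ℝ) : ℂ) * (I * deriv γ s)) := by fun_prop
    have := (this.tendsto 0).mono_left (nhdsWithin_le_nhds (s := Ioi 0))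
    simpa using this
  have l1 : Tendsto (fun y : ℝ => EE O γ f τ (γ t + ((e * y : ℝ) : ℂ) * (I * deriv γ s))) (𝓝[>] 0)
      (𝓝 (EE O γ f τ (γ t))) := by
    refine Tendsto.comp (D.ee_cont hf0 (γ t) (Or.inr ⟨t, rfl⟩)) ?_
    rw [tendsto_nhdsWithin_iff]
    refine ⟨l0, ?_⟩
    filter_upwards [Ioo_mem_nhdsGT D.hη] with y hy
    exact Or.inl (D.sd s ⟨t, y, ht, hy.1, hy.2, rfl⟩)
  have l2 := ((l1.sub_const (EE O γ f τ (γ s))).sub ((l0.sub_const (γ s)).const_mul (EE O γ (dd γ f) τ (γ s)))).norm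
  have l3 : Tendsto (fun y : ℝ => C * (|t - s| + y) ^ a * (|t - s| + y)) (𝓝[>] 0)
      (𝓝 (C * |t - s| ^ a * |t - s|)) := by
    have c1 : Continuous fun y : ℝ => |t - s| + y := by fun_prop
    have : Continuous fun y : ℝ => C * (|t - s| + y) ^ a * (|t - s| + y) :=
      (continuous_const.mul (c1.rpow_const fun _ => Or.inr D.cv.ha.le)).mul c1
    have := (this.tendsto 0).mono_left (nhdsWithin_le_nhds (s := Ioi 0))
    simpa using this
  refine le_of_tendsto_of_tendsto l2 l3 ?_
  filter_upwards [Ioo_mem_nhdsGT D.hη] with y hy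
  exact H t y ht hy.1 hy.2

theorem ee_deriv (D : Side O γ a τ η e) {f : ℝ → ℂ} (hf : CH a 1 f) {z : ℂ} (hz : z ∈ O ∪ range γ) :
    HasDerivWithinAt (EE O γ f τ) (EE O γ (dd γ f) τ z) (O ∪ range γ) z := by
  have h := D.cv
  rcases hz with hO | ⟨s, rfl⟩
  · have d1 : HasDerivAt (EE O γ f τ) (EE O γ (dd γ f) τ z) z := by
      rw [ee_O hO]
      refine (cau_hasDeriv h hf (D.miss _ hO)).congr_of_eventuallyEq ?_
      filter_upwards [D.op.mem_nhds hO] with w hw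
      exact ee_O hw
    exact d1.hasDerivWithinAt
  obtain ⟨C0, hC0, H0⟩ := D.bd_est0 hf s
  obtain ⟨C1, hC1, H1⟩ := D.bd_est1 hf s
  obtain ⟨c, η', hc, hη', hη4, T⟩ := h.trans
  set C := max C0 C1 with hC
  set δ := min η η' with hδ
  have hδ0 : 0 < δ := lt_min D.hη hη'
  have key : ∀ᶠ w in 𝓝[O ∪ range γ] (γ s), ‖EE O γ f τ w - EE O γ f τ (γ s) - EE O γ (dd γ f) τ (γ s) *
        (w - γ s)‖ ≤ C * (‖w - γ s‖ / c) ^ a * (‖w - γ s‖ / c) := by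
    filter_upwards [nhdsWithin_le_nhds (box_nhds h s hδ0), self_mem_nhdsWithin] with w hw hwS
    obtain ⟨t, y, ht, hy, rfl⟩ := hw
    have htη : |t - s| < η := ht.trans_le (min_le_left _ _)
    have hyη : |y| < η := hy.trans_le (min_le_left _ _)
    have htη' : |t - s| < η' := ht.trans_le (min_le_right _ _)
    have hyη' : |y| < η' := hy.trans_le (min_le_right _ _)
    have hT := T s t y (s - t) htη'.le hyη'.le (by rw [abs_sub_comm]; linarith)
    rw [add_sub_cancel, norm_sub_rev, abs_sub_comm s t] at hT
    have hT' : |t - s| + |y| ≤ ‖γ t + y * (I * deriv γ s) - γ s‖ / c := by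
      rw [le_div_iff₀ hc]; linarith
    have hmono : ∀ C', C' ≤ C → C' * (|t - s| + |y|) ^ a * (|t - s| + |y|) ≤
        C * (‖γ t + y * (I * deriv γ s) - γ s‖ / c) ^ a * (‖γ t + y * (I * deriv γ s) - γ s‖ / c) := by
      intro C' hC'
      have := Real.rpow_le_rpow (by positivity) hT' h.ha.le
      have : 0 ≤ C := hC0.trans (le_max_left _ _)
      gcongr
    rcases eq_or_ne y 0 with rfl | hy0
    · refine le_trans ?_ (hmono C1 (le_max_right _ _))
      simpa using H1 t htη
    · have hyp := abs_pos.2 hy0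
      have hey : e * |y| = y ∨ e * |y| = -y := by
        rcases D.he with rfl | rfl <;> rcases abs_cases y with ⟨h1, _⟩ | ⟨h1, _⟩ <;> simp [h1]
      rcases hey with hey | hey
      · refine le_trans ?_ (hmono C0 (le_max_left _ _))
        have := H0 t |y| htη hyp hyη
        rwa [hey] at this
      · exfalso
        have hm : γ t + y * (I * deriv γ s) ∈ Sd γ s η (-e) :=
          ⟨t, |y|, htη, hyp, hyη, by rw [neg_mul, hey, neg_neg]⟩
        rcases hwS with hw | hw
        · exact D.sd' s _ hm hw
        · refine shift_half h t ?_ hw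
          intro x hx e1
          have := T s t y x htη'.le hyη'.le hx
          rw [e1, sub_self, norm_zero] at this
          have : 0 < c * (|x| + |y|) := by positivity
          linarith
  rw [hasDerivWithinAt_iff_isLittleO, Asymptotics.isLittleO_iff]
  intro ε hε
  have hsm : ∀ᶠ w in 𝓝[O ∪ range γ] (γ s), C * (‖w - γ s‖ / c) ^ a / c < ε := by
    apply nhdsWithin_le_nhds
    have : Continuous fun w : ℂ => C * (‖w - γ s‖ / c) ^ a / c := by
      have : Continuous fun w : ℂ => ‖w - γ s‖ / c := by fun_prop
      exact (continuous_const.mul (this.rpow_const fun _ => Or.inr h.ha.le)).div_const _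
    refine (this.tendsto (γ s)).eventually_lt_const ?_
    simp [Real.zero_rpow h.ha.ne', hε]
  filter_upwards [key, hsm] with w h1 h2
  rw [smul_eq_mul, mul_comm (w - γ s)]
  refine h1.trans ?_
  calc _ = C * (‖w - γ s‖ / c) ^ a / c * ‖w - γ s‖ := by ring
    _ ≤ _ := by gcongr

end Side
end CKA

namespace CKA

variable {γ : ℝ → ℂ} {a : ℝ}

theorem iter_ch (h : Curve γ a) {k : ℕ} (hγ : ∀ m < k, CH a m (deriv γ)) {f : ℝ → ℂ} (hf : CH a k f) :
    ∀ j m, j + m = k → CH a m ((dd γ)^[j] f) := by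
  intro j
  induction j with
  | zero => intro m hm; rw [zero_add] at hm; subst hm; exact hf
  | succ j ih =>
    intro m hm
    rw [Function.iterate_succ_apply']
    exact dd_ch h (hγ m (by omega)) (ih (m+1) (by omega))

/-- the multilinear map attached to a complex number -/
def Lam (j : ℕ) : ℂ →L[ℝ] ContinuousMultilinearMap ℝ (fun _ : Fin j => ℂ) ℂ :=
  (ContinuousLinearMap.toSpanSingleton ℂ (ContinuousMultilinearMap.mkPiAlgebraFin ℝ j ℂ)).restrictScalars ℝ

theorem lam_apply (j : ℕ) (c : ℂ) (v : Fin j → ℂ) : Lam j c v = c * (List.ofFn v).prod := by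
  simp [Lam]

namespace Side
variable {O : Set ℂ} {τ : ℂ} {η e : ℝ}

theorem uniq (D : Side O γ a τ η e) : UniqueDiffOn ℝ (O ∪ range γ) := by
  rintro z (hz | ⟨s, rfl⟩)
  · exact (D.op.uniqueDiffWithinAt hz).mono subset_union_left
  have hη := D.hη
  have key : ∀ T : Set ℝ, Convex ℝ T → (interior T).Nonempty → (0:ℝ) ∈ T →
      (∀ y ∈ T, y = 0 ∨ (0 < e * y ∧ e * y < η)) → UniqueDiffWithinAt ℝ (O ∪ range γ) (γ s) := by
    intro T hT hTi h0 hTy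
    have u : UniqueDiffWithinAt ℝ (Ioo (s - η) (s + η) ×ˢ T) ((s, 0) : ℝ × ℝ) := by
      apply UniqueDiffWithinAt.prod
      · exact isOpen_Ioo.uniqueDiffWithinAt ⟨by linarith, by linarith⟩
      · exact uniqueDiffWithinAt_convex hT hTi (subset_closure h0)
    have := ((phi_strict D.cv s).hasFDerivAt.hasFDerivWithinAt (s := Ioo (s - η) (s + η) ×ˢ T)).uniqueDiffWithinAt u
      (phiL_surj (D.cv.ne s)).denseRange
    have e0 : Phi γ s (s, 0) = γ s := by simp [Phi]
    rw [e0] at this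
    refine this.mono ?_
    rintro _ ⟨⟨t, y⟩, ⟨ht, hy⟩, rfl⟩
    rcases hTy y hy with h | ⟨h1, h2⟩
    · right; refine ⟨t, ?_⟩
      simp [Phi, h]
    · left
      refine D.sd s ⟨t, e * y, ?_, h1, h2, ?_⟩
      · simp only [mem_Ioo] at ht
        exact abs_lt.2 ⟨by linarith [ht.1], by linarith [ht.2]⟩
      · rcases D.he with rfl | rfl <;> simp [Phi]
  rcases D.he with he | he
  · refine key (Ico 0 η) (convex_Ico _ _) ?_ ⟨le_rfl, hη⟩ ?_
    · rw [interior_Ico]; exact nonempty_Ioo.2 hη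
    · intro y hy
      rcases hy.1.eq_or_lt with h | h
      · exact Or.inl h.symm
      · right; rw [he, one_mul]; exact ⟨h, hy.2⟩
  · refine key (Ioc (-η) 0) (convex_Ioc _ _) ?_ ⟨by linarith, le_rfl⟩ ?_
    · rw [interior_Ioc]; exact nonempty_Ioo.2 (by linarith)
    · intro y hy
      rcases hy.2.eq_or_lt with h | h
      · exact Or.inl h
      · right; rw [he]; exact ⟨by linarith, by linarith [hy.1]⟩

theorem taylor (D : Side O γ a τ η e) {k : ℕ} (hγ : ∀ m < k, CH a m (deriv γ)) {f : ℝ → ℂ} (hf : CH a k f) :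
    HasFTaylorSeriesUpToOn k (EE O γ f τ) (fun z j => Lam j (EE O γ ((dd γ)^[j] f) τ z)) (O ∪ range γ) := by
  have h := D.cv
  have hch := iter_ch h hγ hf
  constructor
  · intro z hz
    simp [ContinuousMultilinearMap.curry0, lam_apply]
  · intro m hm z hz
    have hm' : m < k := by exact_mod_cast hm
    have hc : CH a 1 ((dd γ)^[m] f) := by
      have : ∀ n, CH a (n+1) ((dd γ)^[m] f) → CH a 1 ((dd γ)^[m] f) := by
        intro n
        induction n with
        | zero => exact id
        | succ n ih => exact fun hh => ih (CH.mono h.ha h.ha1 hh)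
      exact this (k - m - 1) (hch m _ (by omega))
    have d := (D.ee_deriv hc hz).hasFDerivWithinAt.restrictScalars ℝ
    have d2 := (Lam m).hasFDerivAt.comp_hasFDerivWithinAt z d
    refine d2.congr_fderiv ?_
    ext v w
    rw [ContinuousMultilinearMap.curryLeft_apply]
    simp only [ContinuousLinearMap.comp_apply, lam_apply]
    simp [Function.iterate_succ_apply', List.ofFn_succ]
    ring
  · intro m hm
    have hm' : m ≤ k := by exact_mod_cast hm
    have hc : CH a 0 ((dd γ)^[m] f) := CH.zero h.ha h.ha1 (hch m (k - m) (by omega))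
    exact (Lam m).continuous.comp_continuousOn (D.ee_cont hc)

theorem smooth (D : Side O γ a τ η e) {k : ℕ} (hγ : ∀ m < k, CH a m (deriv γ)) {f : ℝ → ℂ} (hf : CH a k f)
    (b : ℂ) :
    ContDiffOn ℝ k (fun z => b * EE O γ f τ z) (O ∪ range γ) ∧
    ∃ K : ℝ, 0 ≤ K ∧ ∀ z ∈ O ∪ range γ, ∀ w ∈ O ∪ range γ,
      ‖iteratedFDerivWithin ℝ k (fun z => b * EE O γ f τ z) (O ∪ range γ) z -
        iteratedFDerivWithin ℝ k (fun z => b * EE O γ f τ z) (O ∪ range γ) w‖ ≤ K * ‖z - w‖ ^ a := by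
  have T := D.taylor hγ hf
  have hcd : ContDiffOn ℝ k (EE O γ f τ) (O ∪ range γ) := T.contDiffOn
  refine ⟨contDiffOn_const.mul hcd, ?_⟩
  obtain ⟨K, hK, H⟩ := D.ee_hol (iter_ch D.cv hγ hf k 0 (by omega))
  have e1 : ∀ z ∈ O ∪ range γ, iteratedFDerivWithin ℝ k (fun z => b * EE O γ f τ z) (O ∪ range γ) z =
      b • Lam k (EE O γ ((dd γ)^[k] f) τ z) := by
    intro z hz
    have := iteratedFDerivWithin_const_smul_apply (𝕜 := ℝ) (i := k) (a := b) (hcd z hz) D.uniq hz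
    have e2 : (fun z => b * EE O γ f τ z) = b • EE O γ f τ := rfl
    rw [e2, this, ← T.eq_iteratedFDerivWithin_of_uniqueDiffOn le_rfl D.uniq hz]
  refine ⟨‖b‖ * (‖Lam k‖ * K), by positivity, fun z hz w hw => ?_⟩
  rw [e1 z hz, e1 w hw, ← smul_sub, ← map_sub, norm_smul]
  have h1 := (Lam k).le_opNorm (EE O γ ((dd γ)^[k] f) τ z - EE O γ ((dd γ)^[k] f) τ w)
  have h2 := H z hz w hw
  calc _ ≤ ‖b‖ * (‖Lam k‖ * (K * ‖z - w‖ ^ a)) := by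
        refine mul_le_mul_of_nonneg_left (h1.trans ?_) (norm_nonneg _)
        gcongr
    _ = _ := by ring

end Side
end CKA

namespace CKA

variable {γ : ℝ → ℂ} {a : ℝ}

theorem Curve.null (h : Curve γ a) : volume (range γ) = 0 := by
  have hs : volume ((LinearMap.ker Complex.imLm : Submodule ℝ ℂ) : Set ℂ) = 0 := by
    apply Measure.addHaar_submodule
    intro e
    have : I ∈ LinearMap.ker Complex.imLm := by rw [e]; trivial
    simp at this
  have hd : DifferentiableOn ℝ (fun z : ℂ => γ z.re) ((LinearMap.ker Complex.imLm : Submodule ℝ ℂ) : Set ℂ) := by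
    have h1 : Differentiable ℝ (fun z : ℂ => z.re) := Complex.reCLM.differentiable
    exact (h.diff.comp h1).differentiableOn
  have := addHaar_image_eq_zero_of_differentiableOn_of_addHaar_eq_zero volume hd hs
  refine measure_mono_null ?_ this
  rintro _ ⟨t, rfl⟩
  exact ⟨(t:ℂ), by simp, by simp⟩

theorem removable {F : ℂ → ℂ} {J : Set ℂ} (hJ : volume J = 0) (hL : LocallyLipschitz F)
    (hd : ∀ z, z ∉ J → DifferentiableAt ℂ F z) (hinf : Tendsto F (cocompact ℂ) (𝓝 0)) (z₁ : ℂ) : F z₁ = 0 := by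
  have hc : Continuous F := hL.continuous
  have hentire : ∀ r : ℝ, Differentiable ℂ (fun z => ∫ w in ball (0:ℂ) r, F (z + w)) := by
    intro r z
    obtain ⟨K, hK⟩ := LocallyLipschitzOn.exists_lipschitzOnWith_of_compact
      (isCompact_closedBall z (|r| + 1)) (hL.locallyLipschitzOn (s := closedBall z (|r| + 1)))
    refine (hasDerivAt_integral_of_dominated_loc_of_lip (𝕜 := ℂ) (bound := fun _ => (K:ℝ)) (F := fun z w => F (z + w))
      (F' := fun w => deriv F (z + w)) (s := ball z 1) (ball_mem_nhds z one_pos) ?_ ?_ ?_ ?_ ?_ ?_).2.differentiableAt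
    · refine Eventually.of_forall fun x => Continuous.aestronglyMeasurable ?_
      fun_prop
    · have : Continuous fun w => F (z + w) := by fun_prop
      exact (this.continuousOn.integrableOn_compact (isCompact_closedBall 0 r)).mono_set ball_subset_closedBall
    · exact ((measurable_deriv F).comp (measurable_const_add z)).aestronglyMeasurable
    · refine (ae_restrict_iff' measurableSet_ball).2 (Eventually.of_forall fun w hw => ?_)
      have hKK : Real.nnabs (K:ℝ) = K := NNReal.eq (by simp)
      simp only [hKK]
      rw [lipschitzOnWith_iff_dist_le_mul] at hK ⊢
      intro x hx y hy
      have hin : ∀ x ∈ ball z 1, x + w ∈ closedBall z (|r| + 1) := by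
        intro x hx
        rw [mem_ball, dist_eq_norm] at hx
        rw [mem_ball_zero_iff] at hw
        rw [mem_closedBall, dist_eq_norm, show x + w - z = w + (x - z) by ring]
        exact (norm_add_le _ _).trans (add_le_add (hw.le.trans (le_abs_self r)) hx.le)
      have := hK _ (hin x hx) _ (hin y hy)
      rwa [dist_add_right] at this
    · have : volume (ball (0:ℂ) r) ≠ ∞ := measure_ball_lt_top.ne
      exact integrableOn_const this
    · apply ae_restrict_of_ae
      have hn : volume ((fun w => z + w) ⁻¹' J) = 0 := by
        rw [measure_preimage_add]; exact hJ
      filter_upwards [compl_mem_ae_iff.2 hn] with w hw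
      have := (hd (z + w) hw).hasDerivAt
      exact this.comp_add_const z w
  have hzero : ∀ r > 0, ∀ z, ∫ w in ball (0:ℂ) r, F (z + w) = 0 := by
    intro r hr z
    apply (hentire r).apply_eq_of_tendsto_cocompact z
    rw [Metric.tendsto_nhds]
    intro ε hε
    have hv : 0 < volume.real (ball (0:ℂ) r) := by
      rw [measureReal_def]
      exact ENNReal.toReal_pos (measure_ball_pos _ _ hr).ne' measure_ball_lt_top.ne
    set ε' := ε / (2 * volume.real (ball (0:ℂ) r)) with hε'
    have hε'0 : 0 < ε' := by positivity
    have h1 := Metric.tendsto_nhds.1 hinf ε' hε'0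
    rw [← Metric.cobounded_eq_cocompact] at h1 ⊢
    rw [← comap_norm_atTop, eventually_comap] at h1 ⊢
    obtain ⟨R, hR⟩ := eventually_atTop.1 h1
    filter_upwards [eventually_ge_atTop (R + r)] with b hb z hz
    rw [dist_zero_right]
    refine (norm_setIntegral_le_of_norm_le_const measure_ball_lt_top (C := ε') ?_).trans_lt ?_
    · intro w hw
      rw [mem_ball_zero_iff] at hw
      have : R ≤ ‖z + w‖ := by
        have := norm_sub_le (z + w) w
        rw [add_sub_cancel_right] at this
        linarith
      have := hR _ this (z + w) rfl
      rw [dist_zero_right] at this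
      exact this.le
    · rw [hε']
      have : ε / (2 * volume.real (ball (0:ℂ) r)) * volume.real (ball (0:ℂ) r) = ε / 2 := by field_simp
      rw [this]; linarith
  by_contra hne
  have hp : 0 < ‖F z₁‖ / 2 := by have := norm_pos_iff.2 hne; positivity
  obtain ⟨r, hr, hr'⟩ := Metric.continuousAt_iff.1 (hc.continuousAt (x := z₁)) _ hp
  have hv : 0 < volume.real (ball (0:ℂ) r) := by
    rw [measureReal_def]
    exact ENNReal.toReal_pos (measure_ball_pos _ _ hr).ne' measure_ball_lt_top.ne
  have b1 : ‖∫ w in ball (0:ℂ) r, (F (z₁ + w) - F z₁)‖ ≤ ‖F z₁‖ / 2 * volume.real (ball (0:ℂ) r) := by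
    refine norm_setIntegral_le_of_norm_le_const measure_ball_lt_top fun w hw => ?_
    rw [mem_ball_zero_iff] at hw
    have := hr' (show dist (z₁ + w) z₁ < r by simpa [dist_eq_norm] using hw)
    rw [dist_eq_norm] at this
    exact this.le
  have hi : IntegrableOn (fun w => F (z₁ + w)) (ball (0:ℂ) r) := by
    have : Continuous fun w => F (z₁ + w) := by fun_prop
    exact (this.continuousOn.integrableOn_compact (isCompact_closedBall 0 r)).mono_set ball_subset_closedBall
  rw [integral_sub hi (integrableOn_const measure_ball_lt_top.ne), hzero r hr, setIntegral_const, zero_sub,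
    norm_neg, norm_smul, Real.norm_eq_abs, abs_of_pos hv] at b1
  nlinarith

theorem half_lip (h : Curve γ a) {F : ℂ → ℂ} {X : Set ℂ} (hF : ContDiffOn ℝ 1 F X) {s η e : ℝ} (hη : 0 < η)
    (hX : ∀ t y : ℝ, |t - s| < η → 0 ≤ e * y → e * y < η → γ t + y * (I * deriv γ s) ∈ X) :
    ∃ K δ : ℝ, 0 ≤ K ∧ 0 < δ ∧ ∀ t y t' y' : ℝ, |t - s| < δ → |y| < δ → |t' - s| < δ → |y'| < δ →
      0 ≤ e * y → 0 ≤ e * y' →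
      ‖F (γ t + y * (I * deriv γ s)) - F (γ t' + y' * (I * deriv γ s))‖ ≤ K * (|t - t'| + |y - y'|) := by
  set T : Set (ℝ × ℝ) := Ioo (s - η) (s + η) ×ˢ {y | 0 ≤ e * y ∧ e * y < η} with hT
  have hTc : Convex ℝ T := by
    apply (convex_Ioo _ _).prod
    have : {y : ℝ | 0 ≤ e * y ∧ e * y < η} = (fun y => e • y) ⁻¹' (Ico 0 η) := by ext; simp
    rw [this]
    exact (convex_Ico _ _).smul_preimage e
  have hPhi : ContDiff ℝ 1 (Phi γ s) := by
    unfold Phi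
    have := h.cd
    have h2 : ContDiff ℝ 1 (fun p : ℝ × ℝ => (p.2 : ℂ)) := Complex.ofRealCLM.contDiff.comp contDiff_snd
    exact (this.comp contDiff_fst).add (h2.mul contDiff_const)
  have hm : MapsTo (Phi γ s) T X := by
    rintro ⟨t, y⟩ ⟨ht, hy⟩
    exact hX t y (abs_lt.2 ⟨by linarith [ht.1], by linarith [ht.2]⟩) hy.1 hy.2
  have hcomp : ContDiffOn ℝ 1 (F ∘ Phi γ s) T := hF.comp hPhi.contDiffOn hm
  have h0 : ((s, 0) : ℝ × ℝ) ∈ T := ⟨⟨by linarith, by linarith⟩, by simp [hη]⟩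
  obtain ⟨K, V, hV, hK⟩ := (hcomp _ h0).exists_lipschitzOnWith hTc
  obtain ⟨ε, hε, hεV⟩ := Metric.mem_nhdsWithin_iff.1 hV
  set δ := min ε (min η (η / (|e| + 1))) with hδ
  have hδ0 : 0 < δ := by positivity
  have hδ1 : δ ≤ ε := min_le_left _ _
  have hδ2 : δ ≤ η := (min_le_right _ _).trans (min_le_left _ _)
  have hδ3 : δ ≤ η / (|e| + 1) := (min_le_right _ _).trans (min_le_right _ _)
  have hin : ∀ t y : ℝ, |t - s| < δ → |y| < δ → 0 ≤ e * y → ((t, y) : ℝ × ℝ) ∈ V := by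
    intro t y ht hy hey
    apply hεV
    refine ⟨?_, ?_, hey, ?_⟩
    · rw [mem_ball, Prod.dist_eq, max_lt_iff, Real.dist_eq, Real.dist_eq, sub_zero]
      exact ⟨ht.trans_le hδ1, hy.trans_le hδ1⟩
    · have := abs_lt.1 (ht.trans_le hδ2)
      exact ⟨by simp only; linarith [this.1], by simp only; linarith [this.2]⟩
    · have h1 : |y| < η / (|e| + 1) := hy.trans_le hδ3
      rw [lt_div_iff₀ (by positivity)] at h1
      have h2 := le_abs_self (e * y)
      rw [abs_mul] at h2
      simp only
      nlinarith [abs_nonneg y]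
  refine ⟨K, δ, K.2, hδ0, fun t y t' y' h1 h2 h3 h4 h5 h6 => ?_⟩
  have := hK.dist_le_mul _ (hin t y h1 h2 h5) _ (hin t' y' h3 h4 h6)
  rw [dist_eq_norm] at this
  refine this.trans ?_
  have hd : dist ((t, y) : ℝ × ℝ) (t', y') ≤ |t - t'| + |y - y'| := by
    rw [Prod.dist_eq, Real.dist_eq, Real.dist_eq]
    exact max_le (by linarith [abs_nonneg (y - y')]) (by linarith [abs_nonneg (t - t')])
  have := K.2
  exact mul_le_mul_of_nonneg_left hd this

namespace Dom
variable {Ω : Set ℂ}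

theorem unique0 (D : Dom Ω γ a) {F : ℂ → ℂ} (d1 : DifferentiableOn ℂ F Ω) (d2 : DifferentiableOn ℂ F (closure Ω)ᶜ)
    (c1 : ContDiffOn ℝ 1 F (closure Ω)) (c2 : ContDiffOn ℝ 1 F Ωᶜ) (hinf : Tendsto F (cocompact ℂ) (𝓝 0))
    (z : ℂ) : F z = 0 := by
  have h := D.cv
  have hdiff : ∀ z, z ∉ range γ → ∃ U, IsOpen U ∧ z ∈ U ∧ DifferentiableOn ℂ F U := by
    intro z hz
    rcases D.cases z with h1 | h1 | h1
    · exact ⟨Ω, D.op, h1, d1⟩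
    · exact absurd h1 hz
    · exact ⟨_, isClosed_closure.isOpen_compl, h1, d2⟩
  refine removable h.null ?_ (fun z hz => ?_) hinf z
  swap
  · obtain ⟨U, hU, hzU, hd⟩ := hdiff z hz
    exact hd.differentiableAt (hU.mem_nhds hzU)
  intro z
  by_cases hz : z ∈ range γ
  swap
  · obtain ⟨U, hU, hzU, hd⟩ := hdiff z hz
    have : ContDiffAt ℂ 1 F z := (hd.contDiffOn hU).contDiffAt (hU.mem_nhds hzU)
    exact this.exists_lipschitzOnWith
  obtain ⟨s, rfl⟩ := hz
  obtain ⟨η, σ, hη, hσ, -, -, hsd⟩ := D.main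
  have side : ∀ e t y : ℝ, (e = 1 ∨ e = -1) → |t - s| < η → 0 ≤ e * y → e * y < η →
      γ t + y * (I * deriv γ s) ∈ Sd γ s η e ∪ range γ := by
    intro e t y he ht h0 h1
    rcases h0.eq_or_lt with h2 | h2
    · right
      have : y = 0 := by rcases he with rfl | rfl <;> linarith
      subst this; exact ⟨t, by simp⟩
    · left
      refine ⟨t, e * y, ht, h2, h1, ?_⟩
      rcases he with rfl | rfl <;> simp
  have hσ' : -σ = 1 ∨ -σ = -1 := by rcases hσ with rfl | rfl <;> simp
  obtain ⟨K1, δ1, hK1, hδ1, L1⟩ := half_lip (e := σ) (s := s) h c1 hη (by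
    intro t y ht h0 h1
    rw [D.clos]
    exact (side σ t y hσ ht h0 h1).imp_left fun hh => (hsd s).1 hh)
  obtain ⟨K2, δ2, hK2, hδ2, L2⟩ := half_lip (e := -σ) (s := s) h c2 hη (by
    intro t y ht h0 h1 hh
    rcases side (-σ) t y hσ' ht h0 h1 with h3 | h3
    · exact (hsd s).2 h3 (subset_closure hh)
    · exact D.notMem hh h3)
  obtain ⟨c, η', hc, hη', hη4, Tr⟩ := h.trans
  set δ := min (min δ1 δ2) η' with hδ
  have hδ0 : 0 < δ := by positivity
  have e1 : δ ≤ δ1 := (min_le_left _ _).trans (min_le_left _ _)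
  have e2 : δ ≤ δ2 := (min_le_left _ _).trans (min_le_right _ _)
  have e3 : δ ≤ η' := min_le_right _ _
  set K := max K1 K2 with hK
  have hK0 : 0 ≤ K := hK1.trans (le_max_left _ _)
  set Q : ℝ → ℝ → ℂ := fun t y => γ t + y * (I * deriv γ s) with hQ
  -- same side
  have same : ∀ t y t' y' : ℝ, |t - s| < δ → |y| < δ → |t' - s| < δ → |y'| < δ →
      ((0 ≤ σ * y ∧ 0 ≤ σ * y') ∨ (σ * y ≤ 0 ∧ σ * y' ≤ 0)) →
      ‖F (Q t y) - F (Q t' y')‖ ≤ K * (|t - t'| + |y - y'|) := by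
    rintro t y t' y' h1 h2 h3 h4 (⟨h5, h6⟩ | ⟨h5, h6⟩)
    · refine (L1 t y t' y' (by linarith) (by linarith) (by linarith) (by linarith) h5 h6).trans ?_
      gcongr; exact le_max_left _ _
    · refine (L2 t y t' y' (by linarith) (by linarith) (by linarith) (by linarith) (by linarith)
        (by linarith)).trans ?_
      gcongr; exact le_max_right _ _
  have opp : ∀ t y t' y' : ℝ, |t - s| < δ → |y| < δ → |t' - s| < δ → |y'| < δ →
      0 ≤ σ * y → σ * y' ≤ 0 →
      ‖F (Q t y) - F (Q t' y')‖ ≤ K * (|t - t'| + |y - y'|) := by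
    intro t y t' y' h1 h2 h3 h4 h5 h6
    have b1 := same t y t 0 h1 h2 h1 (by simpa using hδ0) (Or.inl ⟨h5, by simp⟩)
    have b2 := same t 0 t' y' h1 (by simpa using hδ0) h3 h4 (Or.inr ⟨by simp, h6⟩)
    have e : |y - 0| + |0 - y'| = |y - y'| := by
      rcases hσ with rfl | rfl
      · rw [sub_zero, zero_sub, abs_neg, abs_of_nonneg (by linarith), abs_of_nonpos (by linarith),
          abs_of_nonneg (by linarith)]; ring
      · rw [sub_zero, zero_sub, abs_neg, abs_of_nonpos (by linarith), abs_of_nonneg (by linarith),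
          abs_of_nonpos (by linarith)]; ring
    rw [sub_self, abs_zero, zero_add] at b1
    have : F (Q t y) - F (Q t' y') = (F (Q t y) - F (Q t 0)) + (F (Q t 0) - F (Q t' y')) := by ring
    rw [this, ← e]
    refine (norm_add_le _ _).trans ?_
    linarith
  have all : ∀ t y t' y' : ℝ, |t - s| < δ → |y| < δ → |t' - s| < δ → |y'| < δ →
      ‖F (Q t y) - F (Q t' y')‖ ≤ K * (|t - t'| + |y - y'|) := by
    intro t y t' y' h1 h2 h3 h4
    rcases le_total 0 (σ * y) with h5 | h5 <;> rcases le_total 0 (σ * y') with h6 | h6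
    · exact same t y t' y' h1 h2 h3 h4 (Or.inl ⟨h5, h6⟩)
    · exact opp t y t' y' h1 h2 h3 h4 h5 h6
    · rw [norm_sub_rev, abs_sub_comm, abs_sub_comm y]
      exact opp t' y' t y h3 h4 h1 h2 h6 h5
    · exact same t y t' y' h1 h2 h3 h4 (Or.inr ⟨h5, h6⟩)
  have hδ2' : 0 < δ / 2 := by positivity
  refine ⟨Real.toNNReal (K / c), _, box_nhds h s hδ2', ?_⟩
  apply LipschitzOnWith.of_dist_le_mul
  rintro _ ⟨t, y, ht, hy, rfl⟩ _ ⟨t', y', ht', hy', rfl⟩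
  rw [Real.coe_toNNReal _ (by positivity), dist_eq_norm, dist_eq_norm]
  refine (all t y t' y' (by linarith) (by linarith) (by linarith) (by linarith)).trans ?_
  have hyy : |y' - y| ≤ η' := by
    refine (abs_sub _ _).trans ?_
    linarith
  have htt : |t - t'| ≤ 1/2 := by
    have : t - t' = (t - s) - (t' - s) := by ring
    rw [this]
    refine (abs_sub _ _).trans ?_
    linarith
  have := Tr s t' (y' - y) (t - t') (by linarith) hyy htt
  rw [add_sub_cancel, abs_sub_comm y'] at this
  have e4 : γ t - (γ t' + ((y' - y : ℝ):ℂ) * (I * deriv γ s)) =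
      γ t + y * (I * deriv γ s) - (γ t' + y' * (I * deriv γ s)) := by push_cast; ring
  rw [e4] at this
  calc _ = K / c * (c * (|t - t'| + |y - y'|)) := by field_simp
    _ ≤ _ := by gcongr

end Dom
end CKA

namespace CKA

variable {γ : ℝ → ℂ} {a : ℝ}

theorem holderOn_of {E : Type*} [NormedAddCommGroup E] {α : ℝ≥0} {g : ℂ → E} {S : Set ℂ} {K : ℝ} (hK : 0 ≤ K)
    (hg : ∀ z ∈ S, ∀ w ∈ S, ‖g z - g w‖ ≤ K * ‖z - w‖ ^ (α:ℝ)) :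
    HolderOnWith (Real.toNNReal K) α g S := by
  intro z hz w hw
  rw [edist_dist, edist_dist, dist_eq_norm, dist_eq_norm,
    ENNReal.ofReal_rpow_of_nonneg (norm_nonneg _) α.coe_nonneg]
  change _ ≤ ENNReal.ofReal K * _
  rw [← ENNReal.ofReal_mul hK]
  exact ENNReal.ofReal_le_ofReal (hg z hz w hw)

theorem inj_of (hp : Function.Periodic γ 1) (hi : InjOn γ (Ico 0 1)) (s t : ℝ) (h : |t - s| < 1)
    (e : γ s = γ t) : s = t := by
  have hf : ∀ x, γ (Int.fract x) = γ x := fun x => by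
    have := hp.sub_int_mul_eq (x := x) ⌊x⌋
    rwa [mul_one] at this
  have h1 : Int.fract s = Int.fract t :=
    hi ⟨Int.fract_nonneg s, Int.fract_lt_one s⟩ ⟨Int.fract_nonneg t, Int.fract_lt_one t⟩
      (by rw [hf, hf, e])
  have h2 : t - s = ((⌊t⌋ - ⌊s⌋ : ℤ) : ℝ) := by
    have := Int.floor_add_fract s
    have := Int.floor_add_fract t
    push_cast
    linarith
  rw [h2] at h
  have h3 : |⌊t⌋ - ⌊s⌋| < 1 := by exact_mod_cast h
  rw [Int.abs_lt_one_iff] at h3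
  rw [h3] at h2
  simp at h2
  linarith

theorem ch_le {f : ℝ → ℂ} (ha : 0 < a) (ha1 : a < 1) {n : ℕ} (hf : CH a n f) : ∀ m ≤ n, CH a m f := by
  intro m hm
  induction hm using Nat.decreasingInduction with
  | self => exact hf
  | of_succ k hk ih => exact CH.mono ha ha1 ih

end CKA

/-- **`C^{k,α}` `h + H` decomposition** (Theorem 1.1 (iii)).  Let `k ≥ 1`, `0 < α < 1`,
and let `Ω` be a bounded Jordan domain of class `C^{k,α}`.  Every `u ∈ C^{k,α}(bΩ)`
(i.e. `u ∘ γ ∈ C^{k,α}` for the boundary parametrization `γ`) can be written uniquely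
as `u = h + H` on `bΩ`, where `h` is holomorphic on `Ω` and belongs to `C^{k,α}(Ω̄)`,
and `H` is holomorphic on `ℂ ∖ Ω̄`, belongs to `C^{k,α}(ℂ ∖ Ω)`, and vanishes at
infinity. -/
theorem ckalpha_decomposition
    (k : ℕ) (hk : 1 ≤ k) (α : ℝ≥0) (hα0 : 0 < α) (hα1 : α < 1)
    (Ω : Set ℂ) (γ : ℝ → ℂ) (hΩ : CkAlphaJordanDomain Ω γ k α)
    (u : ℂ → ℂ)
    (hu : ContDiff ℝ k (u ∘ γ) ∧
      ∃ C : ℝ≥0, HolderOnWith C α (iteratedDeriv k (u ∘ γ)) (Icc 0 1)) :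
    ∃ h H : ℂ → ℂ,
      (DifferentiableOn ℂ h Ω ∧ CkAlphaOn h k α (closure Ω) ∧
       DifferentiableOn ℂ H (closure Ω)ᶜ ∧ CkAlphaOn H k α Ωᶜ ∧
       Tendsto H (cocompact ℂ) (𝓝 0) ∧
       EqOn u (h + H) (frontier Ω)) ∧
      (∀ h' H' : ℂ → ℂ,
        (DifferentiableOn ℂ h' Ω ∧ CkAlphaOn h' k α (closure Ω) ∧
         DifferentiableOn ℂ H' (closure Ω)ᶜ ∧ CkAlphaOn H' k α Ωᶜ ∧
         Tendsto H' (cocompact ℂ) (𝓝 0) ∧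
         EqOn u (h' + H') (frontier Ω)) →
        EqOn h h' (closure Ω) ∧ EqOn H H' Ωᶜ) := by
  have ha : (0:ℝ) < α := by exact_mod_cast hα0
  have ha1 : (α:ℝ) < 1 := by exact_mod_cast hα1
  obtain ⟨n, rfl⟩ : ∃ n, k = n + 1 := ⟨k - 1, by omega⟩
  have hper : Function.Periodic (u ∘ γ) 1 := fun t => by simp [hΩ.periodic t]
  have hγ := CKA.CH.of_contDiff hα0 hΩ.periodic hΩ.smooth hΩ.holder
  have hf := CKA.CH.of_contDiff hα0 hper hu.1 hu.2
  have hγ' : ∀ m < n + 1, CKA.CH (α:ℝ) m (deriv γ) := fun m hm =>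
    CKA.ch_le ha ha1 hγ.2.2 m (by omega)
  have hk1 : (1 : WithTop ℕ∞) ≤ ((n + 1 : ℕ) : WithTop ℕ∞) := by exact_mod_cast hk
  have cv : CKA.Curve γ (α:ℝ) :=
    ⟨ha, ha1, hΩ.periodic, hΩ.smooth.of_le hk1, hΩ.derivNe, CKA.inj_of hΩ.periodic hΩ.injOn,
      (hγ' 0 (by omega)).2⟩
  have D : CKA.Dom Ω γ (α:ℝ) :=
    ⟨cv, hΩ.isOpen, hΩ.bounded, hΩ.nonempty, by rw [cv.range_eq, hΩ.image]⟩
  have hfc : Continuous (u ∘ γ) := hu.1.continuous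
  obtain ⟨η, σ, hη, hσ, hi, ho, hs⟩ := D.main
  have D1 : CKA.Side Ω γ (α:ℝ) (σ:ℂ) η σ :=
    { cv := cv
      op := D.op
      miss := fun z hz => D.notMem hz
      ind := hi
      he := hσ
      hη := hη
      sd := fun t => (hs t).1
      sd' := fun t z hz hz' => (hs t).2 hz (subset_closure hz')
      cl := fun P hP hd ⟨z, hz, hzO⟩ => (D.pre_cases hP hd).resolve_right
        fun h => h hz (subset_closure hzO) }
  have D2 : CKA.Side (closure Ω)ᶜ γ (α:ℝ) 0 η (-σ) :=
    { cv := cv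
      op := isClosed_closure.isOpen_compl
      miss := fun z hz => D.extNotMem hz
      ind := ho
      he := by rcases hσ with h | h <;> simp [h]
      hη := hη
      sd := fun t => (hs t).2
      sd' := fun t z hz hz' => by
        rw [neg_neg] at hz
        exact hz' (subset_closure ((hs t).1 hz))
      cl := fun P hP hd ⟨z, hz, hzO⟩ => (D.pre_cases hP hd).resolve_left
        fun h => hzO (subset_closure (h hz)) }
  have e1 : Ω ∪ range γ = closure Ω := D.clos.symm
  have e2 : (closure Ω)ᶜ ∪ range γ = Ωᶜ := by
    ext z
    constructor
    · rintro (h | h) hz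
      · exact h (subset_closure hz)
      · exact D.notMem hz h
    · intro hz
      rcases D.cases z with h | h | h
      · exact absurd h hz
      · exact Or.inr h
      · exact Or.inl h
  have hσ2 : (σ:ℂ) * σ = 1 := by rcases hσ with h | h <;> simp [h]
  have s1 := D1.smooth hγ' hf (σ:ℂ)
  have s2 := D2.smooth hγ' hf (-(σ:ℂ))
  rw [e1] at s1
  rw [e2] at s2
  have hev : (closure Ω)ᶜ ∈ cocompact ℂ := D.bd.isCompact_closure.compl_mem_cocompact
  have main : ∃ h H : ℂ → ℂ, DifferentiableOn ℂ h Ω ∧ CkAlphaOn h (n + 1) α (closure Ω) ∧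
       DifferentiableOn ℂ H (closure Ω)ᶜ ∧ CkAlphaOn H (n + 1) α Ωᶜ ∧
       Tendsto H (cocompact ℂ) (𝓝 0) ∧
       EqOn u (h + H) (frontier Ω) := by
    refine ⟨fun z => (σ:ℂ) * CKA.EE Ω γ (u ∘ γ) σ z,
      fun z => -(σ:ℂ) * CKA.EE (closure Ω)ᶜ γ (u ∘ γ) 0 z, ?_, ?_, ?_, ?_, ?_, ?_⟩
    · have : DifferentiableOn ℂ (fun z => (σ:ℂ) * CKA.Cau γ (u ∘ γ) z) Ω := fun z hz =>
        ((CKA.cau_deriv cv hfc (D.notMem hz)).const_mul _).differentiableAt.differentiableWithinAt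
      exact this.congr fun z hz => by rw [CKA.Side.ee_O hz]
    · obtain ⟨c, K, hK, hK2⟩ := s1
      exact ⟨c, _, CKA.holderOn_of hK hK2⟩
    · have : DifferentiableOn ℂ (fun z => -(σ:ℂ) * CKA.Cau γ (u ∘ γ) z) (closure Ω)ᶜ := fun z hz =>
        ((CKA.cau_deriv cv hfc (D.extNotMem hz)).const_mul _).differentiableAt.differentiableWithinAt
      exact this.congr fun z hz => by rw [CKA.Side.ee_O hz]
    · obtain ⟨c, K, hK, hK2⟩ := s2
      exact ⟨c, _, CKA.holderOn_of hK hK2⟩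
    · have h0 := (CKA.cau_infty cv hfc hper).const_mul (-(σ:ℂ))
      rw [mul_zero] at h0
      refine h0.congr' ?_
      filter_upwards [hev] with z hz
      rw [CKA.Side.ee_O hz]
    · rw [D.fr]
      rintro _ ⟨s, rfl⟩
      simp only [Pi.add_apply]
      rw [D1.ee_J hper, D2.ee_J hper, CKA.BV, CKA.BV]
      simp only [Function.comp_apply]
      linear_combination (-(u (γ s))) * hσ2
  obtain ⟨h, H, m1, m2, m3, m4, m5, m6⟩ := main
  refine ⟨h, H, ⟨m1, m2, m3, m4, m5, m6⟩, ?_⟩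
  rintro h' H' ⟨n1, n2, n3, n4, n5, n6⟩
  classical
  let F : ℂ → ℂ := fun z => if z ∈ closure Ω then h z - h' z else H' z - H z
  have F1 : ∀ z ∈ closure Ω, F z = h z - h' z := fun z hz => by simp [F, hz]
  have F2 : ∀ z ∈ Ωᶜ, F z = H' z - H z := by
    intro z hz
    rw [← e2] at hz
    rcases hz with hz | hz
    · have hz' : z ∉ closure Ω := hz
      simp [F, hz']
    · rw [F1 z (by rw [← e1]; exact Or.inr hz)]
      rw [← D.fr] at hz
      have a1 := m6 hz
      have a2 := n6 hz
      simp only [Pi.add_apply] at a1 a2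
      linear_combination a2 - a1
  have hsub : (closure Ω)ᶜ ⊆ Ωᶜ := compl_subset_compl.2 subset_closure
  have F0 := CKA.Dom.unique0 D (F := F)
    ((m1.sub n1).congr fun z hz => F1 z (subset_closure hz))
    ((n3.sub m3).congr fun z hz => F2 z (hsub hz))
    (((m2.1.sub n2.1).of_le hk1).congr F1)
    (((n4.1.sub m4.1).of_le hk1).congr F2)
    (by
      have := n5.sub m5
      rw [sub_zero] at this
      refine this.congr' ?_
      filter_upwards [hev] with z hz
      exact (F2 z (hsub hz)).symm)
  exact ⟨fun z hz => sub_eq_zero.1 ((F1 z hz).symm.trans (F0 z)),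
    fun z hz => (sub_eq_zero.1 ((F2 z hz).symm.trans (F0 z))).symm⟩
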